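/- Let q be a prime power. (a) If n ≥ 6 and (λ;μ) is a symbol of rank n and type ²D_n that is not one of the three symbols (0,n; ), (1,n−1; ), (0,1,n; 1) — whose generic degrees are respectively 1, (q^n+1)(q^{n−1}−q)/(q²−1), (q^{2n}−q²)/(q²−1) — then d(λ;μ) > q^{4n−10}. (b) If n = 5 and (λ;μ) is a symbol of rank 5 and type ²D_5 not among the four symbols (0,5; ), (1,4; ), (0,1,5; 1), (2,3; ) — the last having generic degree q²(q⁴+1)(q⁵+1)/(q+1), which is less than q^{10} — then d(λ;μ) > q^{10}. Consequently, every unipotent complex character of P(CO^−_{2n}(q)^0) (n ≥ 5) other than the characters labeled by the listed symbols has degree greater than q^{4n−10}. -/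

import Mathlib

/-- The exponent `N = C(a+b-2,2) + C(a+b-4,2) + ⋯` appearing in the generic degree formula. -/
def symbN (a b : ℕ) : ℕ := ∑ j ∈ Finset.range (a + b), Nat.choose (a + b - 2 * (j + 1)) 2

/-- `∏_{x < y ∈ l} (q^y - q^x)`. -/
def prodDiff (q : ℚ) (l : Finset ℕ) : ℚ :=
  ∏ x ∈ l, ∏ y ∈ l, if x < y then (q ^ y - q ^ x) else 1

/-- `∏_{x ∈ l, y ∈ m} (q^x + q^y)`. -/
def prodSum (q : ℚ) (l m : Finset ℕ) : ℚ := ∏ x ∈ l, ∏ y ∈ m, (q ^ x + q ^ y)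

/-- `∏_{x ∈ l} ∏_{k=1}^{x} (q^{2k} - 1)`. -/
def prodDen (q : ℚ) (l : Finset ℕ) : ℚ :=
  ∏ x ∈ l, ∏ k ∈ Finset.Icc 1 x, (q ^ (2 * k) - 1)

/-- `(l; m)` is a symbol of rank `n` and type `²D_n`: two strictly increasing sequences of
nonnegative integers (encoded as finite sets), whose numbers `a`, `b` of entries satisfy
`a > b` and `a - b ≡ 2 (mod 4)`, whose first entries are not both `0`, and with
`Σ l + Σ m - ⌊((a+b-1)/2)²⌋ = n`. -/
def IsSymbol2D (n : ℕ) (l m : Finset ℕ) : Prop :=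
  m.card < l.card ∧ (l.card - m.card) % 4 = 2 ∧ ¬(0 ∈ l ∧ 0 ∈ m) ∧
    l.sum id + m.sum id = (l.card + m.card - 1) ^ 2 / 4 + n

/-- The generic degree of a symbol of type `²D_n`. -/
def gdeg2D (q : ℚ) (n : ℕ) (l m : Finset ℕ) : ℚ :=
  ((q ^ n + 1) * (∏ i ∈ Finset.Icc 1 (n - 1), (q ^ (2 * i) - 1)) * prodDiff q l * prodDiff q m *
      prodSum q l m) /
    (2 ^ ((l.card + m.card - 2) / 2) * q ^ symbN l.card m.card * prodDen q l * prodDen q m)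

section GenericDegree

open Finset

/-- The factor by which one entry `y` of the same row changes the generic degree when the entry
`x + 1` is replaced by `x`. -/
def sameRatio (q : ℚ) (x y : ℕ) : ℚ := |q ^ (x + 1) - q ^ y| / |q ^ x - q ^ y|

/-- The factor by which one entry `z` of the opposite row changes the generic degree when the entry
`x + 1` is replaced by `x`. -/
def oppRatio (q : ℚ) (x z : ℕ) : ℚ := (q ^ (x + 1) + q ^ z) / (q ^ x + q ^ z)

lemma prodDiff_empty (q : ℚ) : prodDiff q ∅ = 1 := by simp [prodDiff]

lemma prodSum_empty_right (q : ℚ) (l : Finset ℕ) : prodSum q l ∅ = 1 := by simp [prodSum]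

lemma prodDen_empty (q : ℚ) : prodDen q ∅ = 1 := by simp [prodDen]

lemma prodSum_comm (q : ℚ) (l m : Finset ℕ) : prodSum q l m = prodSum q m l := by
  unfold prodSum
  rw [prod_comm]
  simp only [add_comm]

lemma prodSum_insert {x : ℕ} {s : Finset ℕ} (hx : x ∉ s) (q : ℚ) (m : Finset ℕ) :
    prodSum q (insert x s) m = (∏ z ∈ m, (q ^ x + q ^ z)) * prodSum q s m := by
  simp [prodSum, hx]

lemma prodDen_insert {x : ℕ} {s : Finset ℕ} (hx : x ∉ s) (q : ℚ) :
    prodDen q (insert x s) = (∏ k ∈ Icc 1 x, (q ^ (2 * k) - 1)) * prodDen q s := by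
  simp [prodDen, hx]

lemma prodDiff_insert {q : ℚ} (hq : 1 < q) {x : ℕ} {s : Finset ℕ} (hx : x ∉ s) :
    prodDiff q (insert x s) = (∏ y ∈ s, |q ^ x - q ^ y|) * prodDiff q s := by
  unfold prodDiff
  simp only [prod_insert hx, lt_irrefl, if_false, one_mul, prod_mul_distrib]
  rw [← mul_assoc, ← prod_mul_distrib]
  congr 1
  refine prod_congr rfl fun y hy => ?_
  have hne : x ≠ y := fun h => hx (h ▸ hy)
  rcases lt_or_gt_of_ne hne with h | h
  · have := pow_lt_pow_right₀ hq h
    rw [if_pos h, if_neg h.not_gt, mul_one, abs_of_neg (by linarith)]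
    ring
  · have := pow_lt_pow_right₀ hq h
    rw [if_pos h, if_neg h.not_gt, one_mul, abs_of_pos (by linarith)]

lemma symbN_comm (a b : ℕ) : symbN a b = symbN b a := by
  simp only [symbN, add_comm a b]

lemma symbN_succ_succ (a b : ℕ) : symbN (a + 1) (b + 1) = (a + b).choose 2 + symbN a b := by
  unfold symbN
  rw [show a + 1 + (b + 1) = (a + b + 1) + 1 by ring, sum_range_succ', sum_range_succ, add_comm]
  rw [Nat.choose_eq_zero_of_lt (by omega : a + b + 1 + 1 - 2 * (a + b + 1 + 1) < 2), add_zero]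
  congr 1
  refine sum_congr rfl fun j _ => ?_
  congr 1
  omega

lemma gdeg2D_comm (q : ℚ) (n : ℕ) (l m : Finset ℕ) : gdeg2D q n l m = gdeg2D q n m l := by
  unfold gdeg2D
  rw [prodSum_comm q l m, symbN_comm, add_comm l.card m.card]
  congr 1 <;> ring

lemma pow_two_mul_sub_one_pos {q : ℚ} (hq : 1 < q) {k : ℕ} (hk : 1 ≤ k) :
    0 < q ^ (2 * k) - 1 := by
  have := one_lt_pow₀ hq (by omega : 2 * k ≠ 0)
  linarith

lemma prod_pow_sub_one_pos {q : ℚ} (hq : 1 < q) (x : ℕ) :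
    0 < ∏ k ∈ Icc 1 x, (q ^ (2 * k) - 1) :=
  prod_pos fun _ hk => pow_two_mul_sub_one_pos hq (mem_Icc.1 hk).1

lemma prodDen_pos {q : ℚ} (hq : 1 < q) (l : Finset ℕ) : 0 < prodDen q l :=
  prod_pos fun x _ => prod_pow_sub_one_pos hq x

lemma prodSum_pos {q : ℚ} (hq : 1 < q) (l m : Finset ℕ) : 0 < prodSum q l m :=
  prod_pos fun _ _ => prod_pos fun _ _ => by positivity

lemma prodDiff_pos {q : ℚ} (hq : 1 < q) (l : Finset ℕ) : 0 < prodDiff q l := by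
  refine prod_pos fun x _ => prod_pos fun y _ => ?_
  split_ifs with h
  · have := pow_lt_pow_right₀ hq h
    linarith
  · exact one_pos

lemma gdeg2D_pos {q : ℚ} (hq : 1 < q) (n : ℕ) (l m : Finset ℕ) : 0 < gdeg2D q n l m := by
  have := prodDen_pos hq l
  have := prodDen_pos hq m
  have := prodSum_pos hq l m
  have := prodDiff_pos hq l
  have := prodDiff_pos hq m
  have := prod_pow_sub_one_pos hq (n - 1)
  unfold gdeg2D
  positivity

lemma abs_pow_sub_pow_pos {q : ℚ} (hq : 1 < q) {x y : ℕ} (h : x ≠ y) : 0 < |q ^ x - q ^ y| := by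
  rw [abs_pos, sub_ne_zero]
  exact fun e => h (pow_right_injective₀ (by linarith) hq.ne' e)

/-- The effect on the generic degree of removing a 1-hook. -/
lemma gdeg2D_succ {q : ℚ} (hq : 1 < q) {n x : ℕ} (hn : 1 ≤ n) {s : Finset ℕ} (hx : x ∉ s)
    (hx' : x + 1 ∉ s) (m : Finset ℕ) :
    gdeg2D q (n + 1) (insert (x + 1) s) m =
      gdeg2D q n (insert x s) m * ((q ^ (n + 1) + 1) * (q ^ n - 1) / (q ^ (2 * (x + 1)) - 1) *
        (∏ y ∈ s, sameRatio q x y) * ∏ z ∈ m, oppRatio q x z) := by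
  obtain ⟨n, rfl⟩ : ∃ k, n = k + 1 := ⟨n - 1, by omega⟩
  have h1 := (pow_two_mul_sub_one_pos hq (by omega : 1 ≤ x + 1)).ne'
  have h2 := (prodDen_pos hq s).ne'
  have h3 := (prodDen_pos hq m).ne'
  have h4 := (prod_pow_sub_one_pos hq x).ne'
  have h5 : (∏ y ∈ s, |q ^ x - q ^ y|) ≠ 0 := prod_ne_zero_iff.2 fun y hy =>
    (abs_pow_sub_pow_pos hq (ne_of_mem_of_not_mem hy hx).symm).ne'
  have h6 : (∏ z ∈ m, (q ^ x + q ^ z)) ≠ 0 := prod_ne_zero_iff.2 fun z _ => by positivity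
  have h7 : q ^ (2 * (n + 1)) - 1 = (q ^ (n + 1) - 1) * (q ^ (n + 1) + 1) := by ring
  have h8 : q ^ (n + 1) + 1 ≠ 0 := by positivity
  have h9 : q ≠ 0 := by positivity
  simp only [gdeg2D, sameRatio, oppRatio, prod_div_distrib, prodDiff_insert hq hx,
    prodDiff_insert hq hx', prodSum_insert hx, prodSum_insert hx', prodDen_insert hx,
    prodDen_insert hx', card_insert_of_notMem hx, card_insert_of_notMem hx',
    add_tsub_cancel_right, prod_Icc_succ_top (Nat.le_add_left 1 _), h7]
  field_simp

/-- The shift of a row of a symbol. -/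
def shiftRow (s : Finset ℕ) : Finset ℕ := insert 0 (s.map ⟨Nat.succ, Nat.succ_injective⟩)

lemma zero_notMem_map_succ (s : Finset ℕ) :
    0 ∉ s.map (⟨Nat.succ, Nat.succ_injective⟩ : ℕ ↪ ℕ) := by simp

lemma mem_shiftRow {s : Finset ℕ} {y : ℕ} :
    y ∈ shiftRow s ↔ y = 0 ∨ ∃ x ∈ s, x + 1 = y := by
  simp [shiftRow]

lemma card_shiftRow (s : Finset ℕ) : (shiftRow s).card = s.card + 1 := by
  rw [shiftRow, card_insert_of_notMem (zero_notMem_map_succ s), card_map]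

lemma sum_shiftRow (s : Finset ℕ) : (shiftRow s).sum id = s.sum id + s.card := by
  rw [shiftRow, sum_insert (zero_notMem_map_succ s), sum_map]
  simp [sum_add_distrib]

lemma exists_eq_shiftRow {s : Finset ℕ} (h : 0 ∈ s) : ∃ t, s = shiftRow t := by
  refine ⟨(s.erase 0).image Nat.pred, ?_⟩
  ext y
  simp only [mem_shiftRow, mem_image, mem_erase]
  constructor
  · intro hy
    rcases Nat.eq_zero_or_pos y with h0 | h0
    · exact Or.inl h0
    · exact Or.inr ⟨y - 1, ⟨y, ⟨h0.ne', hy⟩, rfl⟩, by omega⟩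
  · rintro (rfl | ⟨x, ⟨z, ⟨hz, hzs⟩, rfl⟩, rfl⟩)
    · exact h
    · rwa [Nat.pred_eq_sub_one, Nat.sub_add_cancel (Nat.pos_of_ne_zero hz)]

lemma prodDiff_map_succ {q : ℚ} (hq : 1 < q) (s : Finset ℕ) :
    prodDiff q (s.map ⟨Nat.succ, Nat.succ_injective⟩) = q ^ s.card.choose 2 * prodDiff q s := by
  induction s using Finset.induction_on with
  | empty => simp [prodDiff_empty]
  | insert x s hx ih =>
    have h : ∏ y ∈ s, |q ^ (x + 1) - q ^ (y + 1)| = q ^ s.card * ∏ y ∈ s, |q ^ x - q ^ y| := by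
      rw [← prod_const, ← prod_mul_distrib]
      refine prod_congr rfl fun y _ => ?_
      rw [pow_succ, pow_succ, ← sub_mul, abs_mul, abs_of_pos (by linarith : 0 < q), mul_comm]
    rw [map_insert, prodDiff_insert hq (by simpa using hx), prodDiff_insert hq hx, ih, prod_map,
      card_insert_of_notMem hx, Nat.choose_succ_succ' s.card 1, Nat.choose_one_right, pow_add]
    simp only [Function.Embedding.coeFn_mk, Nat.succ_eq_add_one, h]
    ring

lemma prodDiff_shiftRow {q : ℚ} (hq : 1 < q) (s : Finset ℕ) :
    prodDiff q (shiftRow s) =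
      (∏ x ∈ s, (q ^ (x + 1) - 1)) * (q ^ s.card.choose 2 * prodDiff q s) := by
  rw [shiftRow, prodDiff_insert hq (zero_notMem_map_succ s), prodDiff_map_succ hq, prod_map]
  congr 1
  refine prod_congr rfl fun x _ => ?_
  have := one_lt_pow₀ hq (by omega : x + 1 ≠ 0)
  simp only [Function.Embedding.coeFn_mk, Nat.succ_eq_add_one, pow_zero]
  rw [abs_of_neg (by linarith)]
  ring

lemma prodSum_map_succ (q : ℚ) (s t : Finset ℕ) :
    prodSum q (s.map ⟨Nat.succ, Nat.succ_injective⟩) (t.map ⟨Nat.succ, Nat.succ_injective⟩) =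
      q ^ (s.card * t.card) * prodSum q s t := by
  simp only [prodSum, prod_map, Function.Embedding.coeFn_mk, Nat.succ_eq_add_one, pow_succ,
    ← add_mul, prod_mul_distrib, prod_const, ← pow_mul]
  rw [mul_comm t.card, mul_comm]

lemma prodSum_shiftRow (q : ℚ) (s t : Finset ℕ) :
    prodSum q (shiftRow s) (shiftRow t) =
      2 * (∏ x ∈ s, (q ^ (x + 1) + 1)) * (∏ x ∈ t, (q ^ (x + 1) + 1)) *
        (q ^ (s.card * t.card) * prodSum q s t) := by
  rw [shiftRow, shiftRow, prodSum_insert (zero_notMem_map_succ s), prodSum_comm q (s.map _),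
    prodSum_insert (zero_notMem_map_succ t), prodSum_comm q (t.map _), prodSum_map_succ,
    prod_insert (zero_notMem_map_succ t), prod_map, prod_map]
  simp only [Function.Embedding.coeFn_mk, Nat.succ_eq_add_one, pow_zero, add_comm (1 : ℚ)]
  norm_num
  ring

lemma prodDen_shiftRow (q : ℚ) (s : Finset ℕ) :
    prodDen q (shiftRow s) =
      (∏ x ∈ s, (q ^ (x + 1) - 1)) * (∏ x ∈ s, (q ^ (x + 1) + 1)) * prodDen q s := by
  rw [shiftRow, prodDen_insert (zero_notMem_map_succ s)]
  simp only [prodDen, prod_map, Function.Embedding.coeFn_mk, Nat.succ_eq_add_one,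
    ← prod_mul_distrib, Icc_eq_empty_of_lt zero_lt_one, prod_empty, one_mul]
  refine prod_congr rfl fun x _ => ?_
  rw [prod_Icc_succ_top (Nat.le_add_left 1 _)]
  ring

lemma choose_two_add (a b : ℕ) : (a + b).choose 2 = a.choose 2 + b.choose 2 + a * b := by
  induction b with
  | zero => simp
  | succ b ih =>
    rw [← add_assoc, Nat.choose_succ_succ' (a + b) 1, Nat.choose_succ_succ' b 1, ih]
    simp only [Nat.choose_one_right]
    ring

/-- The generic degree is invariant under shift of symbols. -/
lemma gdeg2D_shiftRow {q : ℚ} (hq : 1 < q) (n : ℕ) {l m : Finset ℕ} (h : 2 ≤ l.card + m.card) :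
    gdeg2D q n (shiftRow l) (shiftRow m) = gdeg2D q n l m := by
  have hl : ∏ x ∈ l, (q ^ (x + 1) - 1) ≠ 0 := prod_ne_zero_iff.2 fun x _ => by
    have := one_lt_pow₀ hq (by omega : x + 1 ≠ 0)
    linarith
  have hm : ∏ x ∈ m, (q ^ (x + 1) - 1) ≠ 0 := prod_ne_zero_iff.2 fun x _ => by
    have := one_lt_pow₀ hq (by omega : x + 1 ≠ 0)
    linarith
  have hl' : ∏ x ∈ l, (q ^ (x + 1) + 1) ≠ 0 := prod_ne_zero_iff.2 fun x _ => by positivity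
  have hm' : ∏ x ∈ m, (q ^ (x + 1) + 1) ≠ 0 := prod_ne_zero_iff.2 fun x _ => by positivity
  have h1 := (prodDen_pos hq l).ne'
  have h2 := (prodDen_pos hq m).ne'
  have h9 : q ≠ 0 := by positivity
  have hc : (l.card + 1 + (m.card + 1) - 2) / 2 = (l.card + m.card - 2) / 2 + 1 := by omega
  simp only [gdeg2D, prodDiff_shiftRow hq, prodSum_shiftRow, prodDen_shiftRow, card_shiftRow,
    symbN_succ_succ, choose_two_add, hc]
  generalize ∏ x ∈ l, (q ^ (x + 1) - 1) = a at *
  generalize ∏ x ∈ m, (q ^ (x + 1) - 1) = b at *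
  generalize ∏ x ∈ l, (q ^ (x + 1) + 1) = c at *
  generalize ∏ x ∈ m, (q ^ (x + 1) + 1) = d at *
  simp only [pow_add]
  field_simp

lemma card_mul_card_le (s : Finset ℕ) : (s.card : ℤ) * s.card ≤ 2 * s.sum id + s.card := by
  induction s using Finset.induction_on_max with
  | empty => simp
  | insert x s hx ih =>
    have hxs : x ∉ s := fun h => (hx x h).false
    have hc : s.card ≤ x := by
      have := card_le_card (fun y hy => mem_range.2 (hx y hy) : s ⊆ range x)
      rwa [card_range] at this
    rw [card_insert_of_notMem hxs, sum_insert hxs]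
    push_cast at ih ⊢
    zify at hc
    simp only [id] at *
    linarith

lemma card_mul_card_le_of_notMem {s : Finset ℕ} {c : ℕ} (hc : c ∉ s) :
    ((s.card : ℤ) + 1) * (s.card + 1) ≤ 2 * (s.sum id + c) + (s.card + 1) := by
  have := card_mul_card_le (insert c s)
  rw [card_insert_of_notMem hc, sum_insert hc] at this
  push_cast at this ⊢
  simp only [id] at *
  linarith

lemma card_mul_card_le_of_zero_notMem_of_notMem {s : Finset ℕ} {c : ℕ} (h0 : 0 ∉ s) (hc : c ∉ s)
    (hc0 : c ≠ 0) :
    ((s.card : ℤ) + 2) * (s.card + 2) ≤ 2 * (s.sum id + c) + (s.card + 2) := by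
  have := card_mul_card_le_of_notMem (s := insert 0 s) (c := c) (by simp [hc, hc0])
  rw [card_insert_of_notMem h0, sum_insert h0] at this
  push_cast [id] at this ⊢
  linarith

lemma card_mul_card_le_of_mem {s : Finset ℕ} {y : ℕ} (hy : y ∈ s) :
    ((s.card : ℤ) - 1) * (s.card - 1) ≤ 2 * (s.sum id - y) + (s.card - 1) := by
  have := card_mul_card_le (s.erase y)
  have h1 := card_erase_add_one hy
  have h2 := add_sum_erase s id hy
  zify at h1
  rw [← h1, ← h2]
  push_cast [id] at this ⊢
  linarith

lemma card_mul_card_le_of_zero_notMem_of_mem {s : Finset ℕ} {y : ℕ} (h0 : 0 ∉ s) (hy : y ∈ s) :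
    (s.card : ℤ) * s.card ≤ 2 * (s.sum id - y) + s.card := by
  have := card_mul_card_le_of_mem (mem_insert_of_mem hy : y ∈ insert 0 s)
  rw [card_insert_of_notMem h0, sum_insert h0] at this
  push_cast [id] at this ⊢
  linarith

/-- The pair `(l; m)`, in either order of its rows and not necessarily reduced, is a symbol of
rank `n` and type `²D_n` with `2 * h` entries. -/
structure IsRowPair (n h : ℕ) (l m : Finset ℕ) : Prop where
  card : l.card + m.card = 2 * h
  defect : l.card % 4 = (m.card + 2) % 4
  sum : l.sum id + m.sum id + h = h * h + n

lemma IsRowPair.symm {n h : ℕ} {l m : Finset ℕ} (H : IsRowPair n h l m) : IsRowPair n h m l :=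
  ⟨by have := H.card; omega, by have := H.defect; omega, by have := H.sum; omega⟩

lemma IsSymbol2D.isRowPair {n : ℕ} {l m : Finset ℕ} (H : IsSymbol2D n l m) :
    ∃ h, IsRowPair n h l m := by
  obtain ⟨h1, h2, -, h4⟩ := H
  obtain ⟨h, hh⟩ : ∃ h, l.card + m.card = 2 * (h + 1) := ⟨(l.card + m.card) / 2 - 1, by omega⟩
  refine ⟨h + 1, hh, by omega, ?_⟩
  rw [h4, hh, show 2 * (h + 1) - 1 = 2 * h + 1 by omega,
    show (2 * h + 1) ^ 2 = 4 * (h * (h + 1)) + 1 by ring,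
    show (4 * (h * (h + 1)) + 1) / 4 = h * (h + 1) by omega]
  ring

lemma IsRowPair.of_shiftRow {n h : ℕ} {l m : Finset ℕ}
    (H : IsRowPair n h (shiftRow l) (shiftRow m)) : ∃ k, h = k + 1 ∧ IsRowPair n k l m := by
  obtain ⟨h1, h2, h3⟩ := H
  rw [card_shiftRow, card_shiftRow] at *
  rw [sum_shiftRow, sum_shiftRow] at h3
  obtain ⟨k, rfl⟩ : ∃ k, h = k + 1 := ⟨h - 1, by omega⟩
  refine ⟨k, rfl, by omega, by omega, ?_⟩
  have : (k + 1) * (k + 1) = k * k + 2 * k + 1 := by ring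
  omega

lemma IsRowPair.one_le {n h : ℕ} {l m : Finset ℕ} (H : IsRowPair n h l m) : 1 ≤ h := by
  have := H.card
  have := H.defect
  omega

/-- The combinatorial data left after removing one entry of a symbol: the remaining entries exceed
the minimal configuration by `e` in total, and the sizes of the rows are measured by `j`. -/
structure IsRemainder (h : ℕ) (e j : ℤ) (s m : Finset ℕ) : Prop where
  card_left : (s.card : ℤ) = h + 2 * j
  card_right : (m.card : ℤ) = h - 2 * j - 1
  sum : ((s.sum id + m.sum id : ℕ) : ℤ) = h * h - h + e
  reduced : ¬(0 ∈ s ∧ 0 ∈ m)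

lemma IsRowPair.isRemainder {n h x : ℕ} {s m : Finset ℕ} (H : IsRowPair n h (insert x s) m)
    (hx : x ∉ s) (h0 : ¬(0 ∈ insert x s ∧ 0 ∈ m)) :
    ∃ j, IsRemainder h (n - x) j s m := by
  obtain ⟨h1, h2, h3⟩ := H
  rw [card_insert_of_notMem hx] at h1 h2
  rw [sum_insert hx] at h3
  obtain ⟨j, hj⟩ : ∃ j : ℤ, (s.card : ℤ) = h + 2 * j := ⟨(s.card - h) / 2, by omega⟩
  refine ⟨j, hj, by omega, ?_, fun h => h0 ⟨mem_insert_of_mem h.1, h.2⟩⟩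
  zify at h3
  push_cast
  simp only [id] at *
  linarith

namespace IsRemainder

variable {h : ℕ} {e j : ℤ} {s m : Finset ℕ}

lemma of_zero_notMem_right (H : IsRemainder h e j s m) (h0 : 0 ∉ m) :
    4 * j ^ 2 ≤ e ∧ (∀ c ∉ s, 4 * j ^ 2 + (h + 2 * j - c) ≤ e) ∧
      ∀ c ∉ m, c ≠ 0 → 4 * j ^ 2 + (h - 2 * j - c) ≤ e := by
  obtain ⟨h1, h2, h3, -⟩ := H
  push_cast at h3
  have a1 := card_mul_card_le s
  have a2 := card_mul_card_le_of_notMem h0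
  refine ⟨?_, fun c hc => ?_, fun c hc hc0 => ?_⟩
  · rw [h1] at a1; rw [h2] at a2; push_cast at *; nlinarith
  · have a3 := card_mul_card_le_of_notMem hc
    rw [h1] at a3; rw [h2] at a2; push_cast at *; nlinarith
  · have a3 := card_mul_card_le_of_zero_notMem_of_notMem h0 hc hc0
    rw [h1] at a1; rw [h2] at a3; push_cast at *; nlinarith

lemma of_zero_notMem_left (H : IsRemainder h e j s m) (h0 : 0 ∉ s) :
    (2 * j + 1) ^ 2 ≤ e ∧ (∀ c ∉ s, c ≠ 0 → (2 * j + 1) ^ 2 + (h + 2 * j + 1 - c) ≤ e) ∧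
      ∀ c ∉ m, (2 * j + 1) ^ 2 + (h - 2 * j - 1 - c) ≤ e := by
  obtain ⟨h1, h2, h3, -⟩ := H
  push_cast at h3
  have a1 := card_mul_card_le_of_notMem h0
  have a2 := card_mul_card_le m
  refine ⟨?_, fun c hc hc0 => ?_, fun c hc => ?_⟩
  · rw [h1] at a1; rw [h2] at a2; push_cast at *; nlinarith
  · have a3 := card_mul_card_le_of_zero_notMem_of_notMem h0 hc hc0
    rw [h1] at a3; rw [h2] at a2; push_cast at *; nlinarith
  · have a3 := card_mul_card_le_of_notMem hc
    rw [h1] at a1; rw [h2] at a3; push_cast at *; nlinarith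

lemma nonneg (H : IsRemainder h e j s m) : 0 ≤ e := by
  by_cases h0 : 0 ∈ m
  · have := (H.of_zero_notMem_left fun h => H.reduced ⟨h, h0⟩).1
    nlinarith
  · have := (H.of_zero_notMem_right h0).1
    nlinarith

lemma sub_le_of_mem_left (H : IsRemainder h e j s m) {y : ℕ} (hy : y ∈ s) :
    (y : ℤ) - (h - 1) ≤ e := by
  have hj : 0 ≤ 4 * j ^ 2 - 2 * j ∧ 0 ≤ 4 * j ^ 2 + 2 * j := by
    rcases le_or_gt j 0 with h | h
    · rcases eq_or_lt_of_le h with rfl | h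
      · simp
      · constructor <;> nlinarith
    · constructor <;> nlinarith
  obtain ⟨h1, h2, h3, h4⟩ := H
  push_cast at h3
  by_cases h0 : 0 ∈ m
  · have a1 := card_mul_card_le_of_zero_notMem_of_mem (fun h => h4 ⟨h, h0⟩) hy
    have a2 := card_mul_card_le m
    rw [h1] at a1; rw [h2] at a2; push_cast at *; nlinarith
  · have a1 := card_mul_card_le_of_mem hy
    have a2 := card_mul_card_le_of_notMem h0
    rw [h1] at a1; rw [h2] at a2; push_cast at *; nlinarith

lemma sub_le_of_mem_right (H : IsRemainder h e j s m) {y : ℕ} (hy : y ∈ m) :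
    (y : ℤ) - (h - 1) ≤ e := by
  have hj : 0 ≤ 4 * j ^ 2 + 2 * j ∧ 0 ≤ 4 * j ^ 2 + 6 * j + 2 := by
    rcases lt_or_ge j 0 with h | h
    · constructor <;> nlinarith
    · constructor <;> nlinarith
  obtain ⟨h1, h2, h3, h4⟩ := H
  push_cast at h3
  by_cases h0 : 0 ∈ m
  · have a1 := card_mul_card_le_of_notMem fun h => h4 ⟨h, h0⟩
    have a2 := card_mul_card_le_of_mem hy
    rw [h1] at a1; rw [h2] at a2; push_cast at *; nlinarith
  · have a1 := card_mul_card_le s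
    have a2 := card_mul_card_le_of_zero_notMem_of_mem h0 hy
    rw [h1] at a1; rw [h2] at a2; push_cast at *; nlinarith

end IsRemainder

lemma sameRatio_pos {q : ℚ} (hq : 1 < q) {x y : ℕ} (h : y ≠ x) (h' : y ≠ x + 1) :
    0 < sameRatio q x y :=
  div_pos (abs_pow_sub_pow_pos hq h'.symm) (abs_pow_sub_pow_pos hq h.symm)

lemma sameRatio_of_lt {q : ℚ} (hq : 1 < q) {x y : ℕ} (h : y < x) :
    sameRatio q x y = (q ^ (x + 1) - q ^ y) / (q ^ x - q ^ y) := by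
  have h1 := pow_lt_pow_right₀ hq h
  have h2 := pow_lt_pow_right₀ hq (h.trans x.lt_add_one)
  rw [sameRatio, abs_of_pos (by linarith), abs_of_pos (by linarith)]

lemma sameRatio_of_gt {q : ℚ} (hq : 1 < q) {x y : ℕ} (h : x + 1 < y) :
    sameRatio q x y = (q ^ y - q ^ (x + 1)) / (q ^ y - q ^ x) := by
  have h1 := pow_lt_pow_right₀ hq h
  have h2 := pow_lt_pow_right₀ hq (x.lt_add_one.trans h)
  rw [sameRatio, abs_of_neg (by linarith), abs_of_neg (by linarith), neg_sub, neg_sub]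

lemma sameRatio_zero_le {q : ℚ} (hq : 1 < q) {x y : ℕ} (h : y < x) :
    (q ^ (x + 1) - 1) / (q ^ x - 1) ≤ sameRatio q x y := by
  have h0 := one_le_pow₀ hq.le (n := y)
  have h1 := pow_lt_pow_right₀ hq h
  rw [sameRatio_of_lt hq h, div_le_div_iff₀ (by linarith) (by linarith), pow_succ]
  have : 0 ≤ (q - 1) * q ^ x * (q ^ y - 1) :=
    mul_nonneg (mul_nonneg (by linarith) (by positivity)) (by linarith)
  nlinarith

lemma le_sameRatio {q : ℚ} (hq : 1 < q) {x y : ℕ} (h : y < x) : q ≤ sameRatio q x y := by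
  refine le_trans ?_ (sameRatio_zero_le hq h)
  have h1 := one_lt_pow₀ hq (by omega : x ≠ 0)
  rw [le_div_iff₀ (by linarith), pow_succ]
  nlinarith

lemma sameRatio_le_one {q : ℚ} (hq : 1 < q) {x y : ℕ} (h : x + 1 < y) : sameRatio q x y ≤ 1 := by
  have h1 := pow_lt_pow_right₀ hq h
  have h2 := pow_lt_pow_right₀ hq (x.lt_add_one)
  rw [sameRatio_of_gt hq h, div_le_one (by linarith)]
  linarith

lemma one_le_oppRatio {q : ℚ} (hq : 1 < q) (x z : ℕ) : 1 ≤ oppRatio q x z := by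
  have h2 := pow_lt_pow_right₀ hq (x.lt_add_one)
  rw [oppRatio, one_le_div (by positivity)]
  linarith

lemma half_le_oppRatio {q : ℚ} (hq : 1 < q) {x z : ℕ} (h : z ≤ x) :
    (q + 1) / 2 ≤ oppRatio q x z := by
  have h1 := pow_le_pow_right₀ hq.le h
  rw [oppRatio, div_le_div_iff₀ (by positivity) (by positivity), pow_succ]
  nlinarith

lemma sameRatio_mul_oppRatio {q : ℚ} (hq : 1 < q) {x y : ℕ} (h : y < x) :
    sameRatio q x y * oppRatio q x y =
      (q ^ (2 * (x + 1)) - q ^ (2 * y)) / (q ^ (2 * x) - q ^ (2 * y)) := by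
  rw [sameRatio_of_lt hq h, oppRatio, div_mul_div_comm]
  congr 1 <;> ring

lemma sq_le_sameRatio_mul_oppRatio {q : ℚ} (hq : 1 < q) {x y : ℕ} (h : y < x) :
    q ^ 2 ≤ sameRatio q x y * oppRatio q x y := by
  have h1 := pow_lt_pow_right₀ hq (by omega : 2 * y < 2 * x)
  have h2 := one_lt_pow₀ hq (by omega : 2 ≠ 0)
  have h3 : 0 < q ^ (2 * y) := by positivity
  rw [sameRatio_mul_oppRatio hq h, le_div_iff₀ (by linarith), mul_add, pow_add, mul_one]
  nlinarith

lemma prod_sameRatio_Ioc {q : ℚ} (hq : 1 < q) (x t : ℕ) :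
    ∏ y ∈ Ioc (x + 1) (x + 1 + t), sameRatio q x y = q ^ t * (q - 1) / (q ^ (t + 1) - 1) := by
  induction t with
  | zero => simp [div_self (by linarith : q - 1 ≠ 0)]
  | succ t ih =>
    have h1 := one_lt_pow₀ hq (by omega : t + 1 ≠ 0)
    have h2 := one_lt_pow₀ hq (by omega : t + 1 + 1 ≠ 0)
    have h3 : 0 < q ^ x := by positivity
    have h4 : q ^ (x + 1 + (t + 1)) - q ^ (x + 1) = q ^ x * q * (q ^ (t + 1) - 1) := by ring
    have h5 : q ^ (x + 1 + (t + 1)) - q ^ x = q ^ x * (q ^ (t + 1 + 1) - 1) := by ring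
    have h6 : q ^ (t + 1) - 1 ≠ 0 := by linarith
    have h7 : q ^ (t + 1 + 1) - 1 ≠ 0 := by linarith
    rw [← add_assoc, prod_Ioc_succ_top (by omega), ih, sameRatio_of_gt hq (by omega),
      add_assoc (x + 1), h4, h5]
    field_simp
    ring

lemma le_prod_sameRatio_of_subset {q : ℚ} (hq : 1 < q) {x t : ℕ} {s : Finset ℕ}
    (hs : s ⊆ Ioc (x + 1) (x + 1 + t)) :
    q ^ t * (q - 1) / (q ^ (t + 1) - 1) ≤ ∏ y ∈ s, sameRatio q x y := by
  have hpos : ∀ y ∈ Ioc (x + 1) (x + 1 + t), 0 < sameRatio q x y := fun y hy => by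
    rw [mem_Ioc] at hy
    exact sameRatio_pos hq (by omega) (by omega)
  rw [← prod_sameRatio_Ioc hq, ← prod_sdiff hs]
  refine mul_le_of_le_one_left (prod_nonneg fun y hy => (hpos y (hs hy)).le) ?_
  refine prod_le_one (fun y hy => (hpos y (mem_sdiff.1 hy).1).le) fun y hy => ?_
  exact sameRatio_le_one hq (mem_Ioc.1 (mem_sdiff.1 hy).1).1

lemma half_le_pow_mul_div {q : ℚ} (hq : 2 ≤ q) (t : ℕ) :
    1 / 2 ≤ q ^ t * (q - 1) / (q ^ (t + 1) - 1) := by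
  have h2 := one_lt_pow₀ (by linarith : 1 < q) (by omega : t + 1 ≠ 0)
  have h3 : 0 < q ^ t := by positivity
  rw [div_le_div_iff₀ (by norm_num) (by linarith), pow_succ]
  nlinarith

/-- The entries below the moved one contribute at least `(q + 1) / 2` each. -/
lemma le_prod_ratio {q : ℚ} (hq : 2 ≤ q) {x t c : ℕ} {s m : Finset ℕ} (hx : x ∉ s)
    (hx' : x + 1 ∉ s) (hs : ∀ y ∈ s, y ≤ x + 1 + t)
    (hc : c ≤ #{y ∈ s | y < x} + #{z ∈ m | z ≤ x}) :
    q ^ t * (q - 1) / (q ^ (t + 1) - 1) * ((q + 1) / 2) ^ c ≤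
      (∏ y ∈ s, sameRatio q x y) * ∏ z ∈ m, oppRatio q x z := by
  have hq1 : 1 < q := by linarith
  have hF : q ^ t * (q - 1) / (q ^ (t + 1) - 1) ≤ ∏ y ∈ s with ¬ y < x, sameRatio q x y := by
    refine le_prod_sameRatio_of_subset hq1 fun y hy => ?_
    rw [mem_filter] at hy
    have h1 := hs y hy.1
    have h2 : y ≠ x := fun h => hx (h ▸ hy.1)
    have h3 : y ≠ x + 1 := fun h => hx' (h ▸ hy.1)
    rw [mem_Ioc]
    omega
  have h0 := half_le_pow_mul_div hq t
  have hA : ((q + 1) / 2) ^ #{y ∈ s | y < x} ≤ ∏ y ∈ s with y < x, sameRatio q x y := by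
    rw [← prod_const]
    refine prod_le_prod (fun _ _ => by linarith) fun y hy => ?_
    have := le_sameRatio hq1 (mem_filter.1 hy).2
    linarith
  have hB : ((q + 1) / 2) ^ #{z ∈ m | z ≤ x} ≤ ∏ z ∈ m, oppRatio q x z := by
    rw [← prod_filter_mul_prod_filter_not m (· ≤ x), ← mul_one (_ ^ _), ← prod_const]
    refine mul_le_mul ?_ ?_ zero_le_one (prod_nonneg fun z _ => ?_)
    · exact prod_le_prod (fun _ _ => by linarith) fun z hz =>
        half_le_oppRatio hq1 (mem_filter.1 hz).2
    · rw [← prod_const_one (s := m.filter (¬ · ≤ x))]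
      exact prod_le_prod (fun _ _ => zero_le_one) fun z _ => one_le_oppRatio hq1 x z
    · linarith [one_le_oppRatio hq1 x z]
  have hp : (0 : ℚ) < (q + 1) / 2 := by linarith
  calc _ ≤ q ^ t * (q - 1) / (q ^ (t + 1) - 1) *
        (((q + 1) / 2) ^ #{y ∈ s | y < x} * ((q + 1) / 2) ^ #{z ∈ m | z ≤ x}) := by
        rw [← pow_add]
        exact mul_le_mul_of_nonneg_left (pow_le_pow_right₀ (by linarith) hc) (by linarith)
    _ ≤ (∏ y ∈ s with ¬ y < x, sameRatio q x y) *
        ((∏ y ∈ s with y < x, sameRatio q x y) * ∏ z ∈ m, oppRatio q x z) := by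
        have h1 : 0 < ((q + 1) / 2) ^ #{y ∈ s | y < x} := by positivity
        have h2 : 0 < ((q + 1) / 2) ^ #{z ∈ m | z ≤ x} := by positivity
        have h3 := h1.le.trans hA
        gcongr
        linarith
    _ = _ := by
        rw [← prod_filter_mul_prod_filter_not s (· < x)]
        ring

lemma le_rank_factor {q : ℚ} (hq : 2 ≤ q) {n x : ℕ} (hn : 5 ≤ n) (hx : x < n) :
    15 / 16 * q ^ (2 * (n - x) - 1) ≤
      (q ^ (n + 1) + 1) * (q ^ n - 1) / (q ^ (2 * (x + 1)) - 1) := by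
  have h1 := pow_two_mul_sub_one_pos (by linarith : 1 < q) (by omega : 1 ≤ x + 1)
  rw [le_div_iff₀ h1]
  have h2 : (32 : ℚ) ≤ q ^ n := by
    calc (32 : ℚ) = 2 ^ 5 := by norm_num
      _ ≤ q ^ 5 := by gcongr
      _ ≤ q ^ n := pow_le_pow_right₀ (by linarith) hn
  have h3 : q ^ (2 * (n - x) - 1) * q ^ (2 * (x + 1)) = q * q ^ n * q ^ n := by
    rw [← pow_add, show 2 * (n - x) - 1 + 2 * (x + 1) = 1 + n + n by omega]
    ring
  have h4 : 0 < q ^ (2 * (n - x) - 1) := by positivity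
  have h5 : 32 * (q * q ^ n) ≤ q * q ^ n * q ^ n := by
    have : 0 ≤ q * q ^ n := by positivity
    nlinarith
  rw [pow_succ]
  nlinarith

lemma prod_le_prod_of_subset_of_one_le_rat {s t : Finset ℕ} {f : ℕ → ℚ} (h : t ⊆ s)
    (hf : ∀ y ∈ s, 1 ≤ f y) : ∏ y ∈ t, f y ≤ ∏ y ∈ s, f y := by
  rw [← prod_sdiff h]
  refine le_mul_of_one_le_left (prod_nonneg fun y hy => ?_) ?_
  · linarith [hf y (h hy)]
  · rw [← prod_const_one (s := s \ t)]
    exact prod_le_prod (fun _ _ => zero_le_one) fun y hy => hf y (mem_sdiff.1 hy).1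

lemma four_thirds_le_oppRatio {q : ℚ} (hq : 2 ≤ q) {x z : ℕ} (h : z ≤ x + 1) :
    4 / 3 ≤ oppRatio q x z := by
  have h1 := pow_le_pow_right₀ (by linarith : 1 ≤ q) h
  have h2 : 0 < q ^ x := by positivity
  rw [oppRatio, div_le_div_iff₀ (by positivity) (by positivity)]
  rw [pow_succ] at *
  nlinarith

/-- The factor by which replacing an entry `x + 1` by `x`, which lowers the rank from `n + 1` to
`n`, changes the generic degree of a symbol. -/
def hookRatio (q : ℚ) (n x : ℕ) (s m : Finset ℕ) : ℚ :=
  (q ^ (n + 1) + 1) * (q ^ n - 1) / (q ^ (2 * (x + 1)) - 1) *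
    (∏ y ∈ s, sameRatio q x y) * ∏ z ∈ m, oppRatio q x z

lemma le_hookRatio_of_large {q : ℚ} (hq : 2 ≤ q) {n x t c : ℕ} (hn : 5 ≤ n) (hxn : x < n)
    {s m : Finset ℕ} (hx : x ∉ s) (hx' : x + 1 ∉ s) (hs : ∀ y ∈ s, y ≤ x + 1 + t)
    (hc : c ≤ #{y ∈ s | y < x} + #{z ∈ m | z ≤ x})
    (H : 4 ≤ n - x ∨ n - x = 3 ∧ (t = 1 ∨ 2 ≤ c) ∨ n - x = 2 ∧ 4 ≤ c ∨ n - x = 1 ∧ 8 ≤ c) :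
    q ^ 4 ≤ hookRatio q n x s m := by
  have h1 := le_rank_factor hq hn hxn
  have h2 := le_prod_ratio hq hx hx' hs hc
  have h3 := half_le_pow_mul_div hq t
  have hp : (3 / 2 : ℚ) ≤ (q + 1) / 2 := by linarith
  have hr : ((q + 1) / 2) ^ 2 ≥ q := by nlinarith [sq_nonneg (q - 1)]
  have hr' : ((q + 1) / 2) ^ 2 ≥ 9 / 4 := by nlinarith
  have h5 : (1 : ℚ) ≤ ((q + 1) / 2) ^ c := one_le_pow₀ (by linarith)
  have h0 : (15 / 16 * q ^ (2 * (n - x) - 1)) *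
      (q ^ t * (q - 1) / (q ^ (t + 1) - 1) * ((q + 1) / 2) ^ c) ≤ hookRatio q n x s m := by
    refine (mul_le_mul h1 h2 ?_ (le_trans (by positivity) h1)).trans_eq (mul_assoc _ _ _).symm
    have : 0 < q ^ (t + 1) - 1 := by
      have := one_lt_pow₀ (by linarith : 1 < q) (by omega : t + 1 ≠ 0)
      linarith
    have : 0 < q - 1 := by linarith
    positivity
  refine le_trans ?_ h0
  rcases H with H | ⟨H, rfl | H'⟩ | ⟨H, H'⟩ | ⟨H, H'⟩
  · have : q ^ 7 ≤ q ^ (2 * (n - x) - 1) := pow_le_pow_right₀ (by linarith) (by omega)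
    calc q ^ 4 ≤ 15 / 16 * q ^ 7 * (1 / 2 * 1) := by
          have : (8 : ℚ) ≤ q ^ 3 := by
            calc (8 : ℚ) = 2 ^ 3 := by norm_num
              _ ≤ q ^ 3 := by gcongr
          have : 0 < q ^ 4 := by positivity
          nlinarith
      _ ≤ _ := by gcongr
  · rw [H]
    have h6 : q ^ 1 * (q - 1) / (q ^ (1 + 1) - 1) = q / (q + 1) := by
      have : q ^ (1 + 1) - 1 = (q - 1) * (q + 1) := by ring
      have : q - 1 ≠ 0 := by linarith
      have : q + 1 ≠ 0 := by linarith
      simp only [*, pow_one]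
      field_simp
    rw [h6]
    calc q ^ 4 ≤ 15 / 16 * q ^ 5 * (q / (q + 1) * 1) := by
          have h7 : 15 / 16 * q ^ 5 * (q / (q + 1) * 1) =
              q ^ 4 * (15 * q ^ 2 / (16 * (q + 1))) := by
            field_simp
          rw [h7]
          refine le_mul_of_one_le_right (by positivity) ?_
          rw [one_le_div (by linarith)]
          nlinarith
      _ ≤ _ := by gcongr
  · rw [H]
    have h6 : ((q + 1) / 2) ^ 2 ≤ ((q + 1) / 2) ^ c := pow_le_pow_right₀ (by linarith) H'
    calc q ^ 4 ≤ 15 / 16 * q ^ 5 * (1 / 2 * (9 / 4)) := by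
          have : 0 < q ^ 4 := by positivity
          nlinarith
      _ ≤ 15 / 16 * q ^ (2 * 3 - 1) * (1 / 2 * ((q + 1) / 2) ^ c) := by
          gcongr
          linarith
      _ ≤ _ := by gcongr
  · rw [H]
    have h6 : ((q + 1) / 2) ^ 4 ≤ ((q + 1) / 2) ^ c := pow_le_pow_right₀ (by linarith) H'
    have h7 : 9 / 4 * q ≤ ((q + 1) / 2) ^ 4 := by
      calc 9 / 4 * q ≤ ((q + 1) / 2) ^ 2 * ((q + 1) / 2) ^ 2 := by gcongr
        _ = _ := by ring
    calc q ^ 4 ≤ 15 / 16 * q ^ 3 * (1 / 2 * (9 / 4 * q)) := by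
          have : 0 < q ^ 4 := by positivity
          nlinarith
      _ ≤ 15 / 16 * q ^ (2 * 2 - 1) * (1 / 2 * ((q + 1) / 2) ^ c) := by
          gcongr
          linarith
      _ ≤ _ := by gcongr
  · rw [H]
    have h6 : ((q + 1) / 2) ^ 8 ≤ ((q + 1) / 2) ^ c := pow_le_pow_right₀ (by linarith) H'
    have h7 : 9 / 4 * (q * q * q) ≤ ((q + 1) / 2) ^ 8 := by
      calc 9 / 4 * (q * q * q) ≤ ((q + 1) / 2) ^ 2 *
            (((q + 1) / 2) ^ 2 * ((q + 1) / 2) ^ 2 * ((q + 1) / 2) ^ 2) := by gcongr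
        _ = _ := by ring
    calc q ^ 4 ≤ 15 / 16 * q ^ 1 * (1 / 2 * (9 / 4 * (q * q * q))) := by
          have : 0 < q ^ 4 := by positivity
          nlinarith
      _ ≤ 15 / 16 * q ^ (2 * 1 - 1) * (1 / 2 * ((q + 1) / 2) ^ c) := by
          gcongr
          linarith
      _ ≤ _ := by gcongr

/-- Bounding the hook ratio below by the contributions of some of the entries. -/
lemma le_hookRatio_of_subset {q : ℚ} (hq : 2 ≤ q) {n x : ℕ} (hn : 5 ≤ n)
    {s m s' m' : Finset ℕ} (hs : ∀ y ∈ s, y < x) (hs' : s' ⊆ s) (hm' : m' ⊆ m) :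
    (q ^ (n + 1) + 1) * (q ^ n - 1) / (q ^ (2 * (x + 1)) - 1) *
      (∏ y ∈ s', sameRatio q x y) * ∏ z ∈ m', oppRatio q x z ≤ hookRatio q n x s m := by
  have hq1 : 1 < q := by linarith
  have h1 := pow_two_mul_sub_one_pos hq1 (by omega : 1 ≤ x + 1)
  have h2 := one_lt_pow₀ hq1 (by omega : n ≠ 0)
  have h3 : 0 ≤ (q ^ (n + 1) + 1) * (q ^ n - 1) / (q ^ (2 * (x + 1)) - 1) := by
    have : 0 < q ^ n - 1 := by linarith
    positivity
  have h4 : ∀ y ∈ s, 1 ≤ sameRatio q x y := fun y hy => by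
    linarith [le_sameRatio hq1 (hs y hy)]
  have h5 := prod_le_prod_of_subset_of_one_le_rat hs' h4
  have h6 := prod_le_prod_of_subset_of_one_le_rat hm' fun z _ => one_le_oppRatio hq1 x z
  have h7 : 0 ≤ ∏ y ∈ s', sameRatio q x y :=
    prod_nonneg fun y hy => by linarith [h4 y (hs' hy)]
  have h8 : 0 ≤ ∏ z ∈ m', oppRatio q x z :=
    prod_nonneg fun z _ => by linarith [one_le_oppRatio hq1 x z]
  unfold hookRatio
  gcongr
  exact mul_nonneg h3 (h7.trans h5)

section TopEntry

variable {q : ℚ} {n h x : ℕ} {e j : ℤ} {s m : Finset ℕ}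

lemma le_hookRatio_top_zero (hq : 2 ≤ q) (hn : 5 ≤ n) (H : IsRemainder h 0 j s m)
    (hs : ∀ y ∈ s, y < n) (hh : 3 ≤ h) : q ^ 4 ≤ hookRatio q n n s m := by
  have hq1 : 1 < q := by linarith
  have h0 : 0 ∉ m := fun h0 => by
    have := (H.of_zero_notMem_left fun h => H.reduced ⟨h, h0⟩).1
    have : (2 * j + 1) ^ 2 = 0 := le_antisymm this (sq_nonneg _)
    have := pow_eq_zero_iff (two_ne_zero) |>.1 this
    omega
  obtain ⟨hj, hl, hr⟩ := H.of_zero_notMem_right h0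
  obtain rfl : j = 0 := by
    have : j ^ 2 = 0 := by nlinarith [sq_nonneg j]
    exact pow_eq_zero_iff (two_ne_zero) |>.1 this
  have hs' : ({0, 1, 2} : Finset ℕ) ⊆ s := fun c hc => by
    by_contra hcs
    have := hl c hcs
    simp only [mem_insert, mem_singleton] at hc
    omega
  have hm' : ({1, 2} : Finset ℕ) ⊆ m := fun c hc => by
    simp only [mem_insert, mem_singleton] at hc
    by_contra hcs
    have := hr c hcs (by omega)
    omega
  refine le_trans ?_ (le_hookRatio_of_subset hq hn hs hs' hm')
  have e0 := sameRatio_zero_le hq1 (by omega : 0 < n)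
  have e1 := sq_le_sameRatio_mul_oppRatio hq1 (by omega : 1 < n)
  have e2 := sq_le_sameRatio_mul_oppRatio hq1 (by omega : 2 < n)
  have h2 := one_lt_pow₀ hq1 (by omega : n ≠ 0)
  have h3 := one_lt_pow₀ hq1 (by omega : n + 1 ≠ 0)
  have e3 : (q ^ (n + 1) + 1) * (q ^ n - 1) / (q ^ (2 * (n + 1)) - 1) *
      ((q ^ (n + 1) - 1) / (q ^ n - 1)) = 1 := by
    have : q ^ (2 * (n + 1)) - 1 = (q ^ (n + 1) - 1) * (q ^ (n + 1) + 1) := by ring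
    have : q ^ n - 1 ≠ 0 := by linarith
    have : q ^ (n + 1) - 1 ≠ 0 := by linarith
    have : q ^ (n + 1) + 1 ≠ 0 := by linarith
    rw [‹q ^ (2 * (n + 1)) - 1 = _›]
    field_simp
  have h4 : 0 ≤ (q ^ (n + 1) + 1) * (q ^ n - 1) / (q ^ (2 * (n + 1)) - 1) := by
    have := pow_two_mul_sub_one_pos hq1 (by omega : 1 ≤ n + 1)
    have : 0 < q ^ n - 1 := by linarith
    positivity
  calc q ^ 4 = 1 * (q ^ 2 * q ^ 2) := by ring
    _ ≤ ((q ^ (n + 1) + 1) * (q ^ n - 1) / (q ^ (2 * (n + 1)) - 1) * sameRatio q n 0) *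
        ((sameRatio q n 1 * oppRatio q n 1) * (sameRatio q n 2 * oppRatio q n 2)) := by
      have e4 := mul_le_mul_of_nonneg_left e0 h4
      rw [e3] at e4
      have e5 := (sq_nonneg q).trans e1
      gcongr
    _ = _ := by
      simp
      ring

lemma le_hookRatio_top_one (hq : 2 ≤ q) (hx : 4 ≤ x) (H : IsRemainder h 1 j s m)
    (hs : ∀ y ∈ s, y < x) (hh : 3 ≤ h) : q ^ 4 ≤ hookRatio q (x + 1) x s m := by
  have hq1 : 1 < q := by linarith
  have e1 := sq_le_sameRatio_mul_oppRatio hq1 (by omega : 1 < x)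
  have h2 := one_lt_pow₀ hq1 (by omega : x ≠ 0)
  have h3 := one_lt_pow₀ hq1 (by omega : x + 1 ≠ 0)
  have h4 := one_lt_pow₀ hq1 (by omega : x + 1 + 1 ≠ 0)
  have e3 : (q ^ (x + 1 + 1) + 1) * (q ^ (x + 1) - 1) / (q ^ (2 * (x + 1)) - 1) =
      (q ^ (x + 1 + 1) + 1) / (q ^ (x + 1) + 1) := by
    have : q ^ (2 * (x + 1)) - 1 = (q ^ (x + 1) - 1) * (q ^ (x + 1) + 1) := by ring
    have : q ^ (x + 1) - 1 ≠ 0 := by linarith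
    have : q ^ (x + 1) + 1 ≠ 0 := by linarith
    rw [‹q ^ (2 * (x + 1)) - 1 = _›]
    field_simp
  by_cases h0 : 0 ∈ m
  · have h0s : 0 ∉ s := fun h => H.reduced ⟨h, h0⟩
    obtain ⟨hj, hl, hr⟩ := H.of_zero_notMem_left h0s
    have hj' : j = 0 ∨ j = -1 := by
      have : j ≤ 0 := by nlinarith
      have : -1 ≤ j := by nlinarith
      omega
    have h1s : 1 ∈ s := by
      by_contra hc
      have := hl 1 hc one_ne_zero
      rcases hj' with rfl | rfl <;> norm_num at this <;> omega
    have h1m : 1 ∈ m := by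
      by_contra hc
      have := hr 1 hc
      rcases hj' with rfl | rfl <;> norm_num at this <;> omega
    have e0 : q ^ 2 ≤
        (q ^ (x + 1 + 1) + 1) / (q ^ (x + 1) + 1) * oppRatio q x 0 * (3 / 2) := by
      have e7 : (q ^ (x + 1 + 1) + 1) / (q ^ (x + 1) + 1) * oppRatio q x 0 * (3 / 2) =
          (q ^ (x + 1 + 1) + 1) * (3 / 2) / (q ^ x + 1) := by
        rw [oppRatio, pow_zero]
        field_simp
      rw [e7, le_div_iff₀ (by positivity)]
      have : q ^ (x + 1 + 1) = q ^ 2 * q ^ x := by ring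
      rw [this]
      have : (16 : ℚ) ≤ q ^ x := by
        calc (16 : ℚ) = 2 ^ 4 := by norm_num
          _ ≤ q ^ 4 := by gcongr
          _ ≤ q ^ x := pow_le_pow_right₀ (by linarith) hx
      nlinarith [sq_nonneg q]
    have h5 : 0 ≤ oppRatio q x 0 := by linarith [one_le_oppRatio hq1 x 0]
    rcases hj' with rfl | rfl
    · have h2s : 2 ∈ s := by
        by_contra hc
        have := hl 2 hc two_ne_zero
        norm_num at this
        omega
      refine le_trans ?_ (le_hookRatio_of_subset (s' := {1, 2}) (m' := {0, 1}) hq (by omega) hs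
        (by simp [insert_subset_iff, *]) (by simp [insert_subset_iff, *]))
      have e2 := le_sameRatio hq1 (by omega : 2 < x)
      calc q ^ 4 = q ^ 2 * q ^ 2 := by ring
        _ ≤ ((q ^ (x + 1 + 1) + 1) / (q ^ (x + 1) + 1) * oppRatio q x 0 * sameRatio q x 2) *
            (sameRatio q x 1 * oppRatio q x 1) := by
          refine mul_le_mul (e0.trans ?_) e1 (by positivity) ?_
          · gcongr
            linarith
          · have : 0 ≤ sameRatio q x 2 := by linarith
            positivity
        _ = _ := by
          rw [e3]
          simp
          ring
    · have h2m : 2 ∈ m := by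
        by_contra hc
        have := hr 2 hc
        norm_num at this
        omega
      refine le_trans ?_ (le_hookRatio_of_subset (s' := {1}) (m' := {0, 1, 2}) hq (by omega) hs
        (by simp [*]) (by simp [insert_subset_iff, *]))
      have e2 := half_le_oppRatio hq1 (by omega : 2 ≤ x)
      calc q ^ 4 = q ^ 2 * q ^ 2 := by ring
        _ ≤ ((q ^ (x + 1 + 1) + 1) / (q ^ (x + 1) + 1) * oppRatio q x 0 * oppRatio q x 2) *
            (sameRatio q x 1 * oppRatio q x 1) := by
          refine mul_le_mul (e0.trans ?_) e1 (by positivity) ?_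
          · gcongr
            linarith
          · have : 0 ≤ oppRatio q x 2 := by linarith
            positivity
        _ = _ := by
          rw [e3]
          simp
          ring
  · obtain ⟨hj, hl, hr⟩ := H.of_zero_notMem_right h0
    obtain rfl : j = 0 := by
      have : j ≤ 0 := by nlinarith
      have : 0 ≤ j := by nlinarith
      omega
    have hs' : ({0, 1} : Finset ℕ) ⊆ s := fun c hc => by
      by_contra hcs
      have := hl c hcs
      simp only [mem_insert, mem_singleton] at hc
      omega
    have hm' : ({1} : Finset ℕ) ⊆ m := fun c hc => by
      simp only [mem_singleton] at hc
      by_contra hcs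
      have := hr c hcs (by omega)
      omega
    refine le_trans ?_ (le_hookRatio_of_subset hq (by omega) hs hs' hm')
    have e0 := sameRatio_zero_le hq1 (by omega : 0 < x)
    have e4 : q ^ 2 ≤ (q ^ (x + 1 + 1) + 1) / (q ^ (x + 1) + 1) *
        ((q ^ (x + 1) - 1) / (q ^ x - 1)) := by
      have : 0 < q ^ x - 1 := by linarith
      rw [div_mul_div_comm, le_div_iff₀ (by positivity)]
      have : 0 ≤ q ^ x * q * (q - 1) ^ 2 + (q ^ 2 - 1) := by
        have : 0 ≤ q ^ 2 - 1 := by nlinarith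
        positivity
      simp only [pow_succ, pow_zero, one_mul] at this ⊢
      linarith
    have h5 : 0 ≤ (q ^ (x + 1 + 1) + 1) / (q ^ (x + 1) + 1) := by positivity
    have e5 := e4.trans (mul_le_mul_of_nonneg_left e0 h5)
    calc q ^ 4 = q ^ 2 * q ^ 2 := by ring
      _ ≤ ((q ^ (x + 1 + 1) + 1) / (q ^ (x + 1) + 1) * sameRatio q x 0) *
          (sameRatio q x 1 * oppRatio q x 1) := by
        have e6 := (sq_nonneg q).trans e5
        gcongr
      _ = _ := by
        rw [e3]
        simp
        ring

lemma le_hookRatio_top_two (hq : 2 ≤ q) (hx : 3 ≤ x) (H : IsRemainder h 2 j s m)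
    (hs : ∀ y ∈ s, y < x) (hm : ∀ z ∈ m, z ≤ x + 1) : q ^ 4 ≤ hookRatio q (x + 2) x s m := by
  have hq1 : 1 < q := by linarith
  have h2 := one_lt_pow₀ hq1 (by omega : x ≠ 0)
  have h3 := one_lt_pow₀ hq1 (by omega : x + 1 ≠ 0)
  have h4 := one_lt_pow₀ hq1 (by omega : x + 2 ≠ 0)
  have e3 : q ^ (2 * (x + 1)) - 1 = (q ^ (x + 1) - 1) * (q ^ (x + 1) + 1) := by ring
  have p1 : 0 < q ^ x - 1 := by linarith
  have p2 : 0 < q ^ (x + 1) - 1 := by linarith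
  have p3 : 0 < q ^ (x + 2) - 1 := by linarith
  have hqx : (8 : ℚ) ≤ q ^ x := by
    calc (8 : ℚ) = 2 ^ 3 := by norm_num
      _ ≤ q ^ 3 := by gcongr
      _ ≤ q ^ x := pow_le_pow_right₀ (by linarith) hx
  rcases s.eq_empty_or_nonempty with rfl | ⟨y, hy⟩
  · have hc := H.card_left
    have hc' := H.card_right
    rw [card_empty] at hc
    have h0 : 0 ∈ m := by
      by_contra h0
      have := (H.of_zero_notMem_right h0).1
      have : j ≤ 0 := by nlinarith
      have : 0 ≤ j := by nlinarith
      omega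
    obtain ⟨z, hz, hz0⟩ : ∃ z ∈ m, z ≠ 0 := by
      by_contra! hcon
      have : m ⊆ {0} := fun z hz => by simpa using hcon z hz
      have := card_le_card this
      rw [card_singleton] at this
      omega
    refine le_trans ?_ (le_hookRatio_of_subset (s' := ∅) (m' := {0, z}) hq (by omega) hs
      (by simp) (by simp [insert_subset_iff, *]))
    have e1 := four_thirds_le_oppRatio hq (hm z hz)
    rw [prod_pair hz0.symm, prod_empty, mul_one, ← mul_assoc, e3]
    have p4 : 0 ≤ (q ^ (x + 2 + 1) + 1) * (q ^ (x + 2) - 1) /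
        ((q ^ (x + 1) - 1) * (q ^ (x + 1) + 1)) * oppRatio q x 0 := by
      have := one_le_oppRatio hq1 x 0
      positivity
    refine le_trans ?_ (mul_le_mul_of_nonneg_left e1 p4)
    have e5 : (q ^ (x + 2 + 1) + 1) * (q ^ (x + 2) - 1) /
        ((q ^ (x + 1) - 1) * (q ^ (x + 1) + 1)) * oppRatio q x 0 =
        (q ^ (x + 2 + 1) + 1) * (q ^ (x + 2) - 1) / ((q ^ (x + 1) - 1) * (q ^ x + 1)) := by
      rw [oppRatio, pow_zero]
      field_simp
    rw [e5, div_mul_eq_mul_div, le_div_iff₀ (by positivity)]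
    simp only [pow_succ, pow_zero, one_mul]
    generalize q ^ x = t at *
    have e6 : 0 ≤ (t - 8) * (t * q ^ 5) + t * q ^ 3 * (5 * q ^ 2 - 4) + 4 * t * q ^ 2 +
        3 * t * q ^ 4 + (3 * q ^ 4 - 4) := by
      have : 0 ≤ t - 8 := by linarith
      have : 0 ≤ 5 * q ^ 2 - 4 := by nlinarith
      have : 0 ≤ 3 * q ^ 4 - 4 := by nlinarith [one_lt_pow₀ hq1 two_ne_zero]
      positivity
    linarith
  · refine le_trans ?_ (le_hookRatio_of_subset (s' := {y}) (m' := ∅) hq (by omega) hs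
      (by simpa using hy) (by simp))
    rw [prod_singleton, prod_empty, mul_one, e3]
    have e1 := sameRatio_zero_le hq1 (hs y hy)
    have p4 : 0 ≤ (q ^ (x + 2 + 1) + 1) * (q ^ (x + 2) - 1) /
        ((q ^ (x + 1) - 1) * (q ^ (x + 1) + 1)) := by positivity
    refine le_trans ?_ (mul_le_mul_of_nonneg_left e1 p4)
    have e5 : (q ^ (x + 2 + 1) + 1) * (q ^ (x + 2) - 1) /
        ((q ^ (x + 1) - 1) * (q ^ (x + 1) + 1)) * ((q ^ (x + 1) - 1) / (q ^ x - 1)) =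
        (q ^ (x + 2 + 1) + 1) * (q ^ (x + 2) - 1) / ((q ^ x - 1) * (q ^ (x + 1) + 1)) := by
      field_simp
    rw [e5, le_div_iff₀ (by positivity)]
    simp only [pow_succ, pow_zero, one_mul]
    generalize q ^ x = t at *
    have e6 : 0 ≤ t * (q ^ 2 * (q - 1) ^ 2 * (q + 1)) + (q ^ 4 - 1) := by
      have : 0 ≤ q ^ 4 - 1 := by linarith [one_lt_pow₀ hq1 four_ne_zero]
      positivity
    linarith

/-- The hook ratio for lowering a largest entry. -/
lemma le_hookRatio_top (hq : 2 ≤ q) (hn : 5 ≤ n) (H : IsRemainder h (n - x) j s m)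
    (hs : ∀ y ∈ s, y < x) (hm : ∀ z ∈ m, z ≤ x + 1) (he : x + 3 ≤ n + h)
    (hex : ¬(n = x + 1 ∧ h = 2)) : q ^ 4 ≤ hookRatio q n x s m := by
  have h0 := H.nonneg
  obtain ⟨k, rfl⟩ : ∃ k, n = x + k := ⟨n - x, by omega⟩
  have hk : ((x + k : ℕ) : ℤ) - x = k := by push_cast; ring
  rw [hk] at H
  rcases (by omega : k = 0 ∨ k = 1 ∨ k = 2 ∨ 3 ≤ k) with rfl | rfl | rfl | hk
  · exact le_hookRatio_top_zero hq hn H hs (by omega)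
  · exact le_hookRatio_top_one hq (by omega) H hs (by omega)
  · exact le_hookRatio_top_two hq (by omega) H hs hm
  · refine le_hookRatio_of_large (t := 1) (c := 0) hq hn (by omega) (fun h => (hs _ h).false)
      (fun h => by have := hs _ h; omega) (fun y hy => by have := hs y hy; omega) (Nat.zero_le _) ?_
    omega

end TopEntry

section RankFive

variable {q : ℚ}

lemma gdeg2D_five_four_entries (hq : 1 < q) :
    gdeg2D q 5 {0, 1, 2} {4} =
      q ^ 3 * (q ^ 2 - q + 1) * (q ^ 4 + 1) * (q ^ 4 - q ^ 3 + q ^ 2 - q + 1) / 2 ∧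
    gdeg2D q 5 {0, 1, 3} {3} =
      q ^ 4 * (q ^ 2 + 1) * (q ^ 4 + 1) * (q ^ 4 - q ^ 3 + q ^ 2 - q + 1) ∧
    gdeg2D q 5 {0, 1, 4} {2} =
      q ^ 3 * (q ^ 2 + q + 1) * (q ^ 2 + 1) ^ 2 * (q ^ 4 - q ^ 3 + q ^ 2 - q + 1) / 2 ∧
    gdeg2D q 5 {0, 2, 3} {2} =
      q ^ 5 * (q ^ 2 + q + 1) * (q ^ 4 + 1) * (q ^ 4 - q ^ 3 + q ^ 2 - q + 1) ∧
    gdeg2D q 5 {0, 2, 4} {1} = q ^ 3 * (q + 1) ^ 2 * (q ^ 3 + 1) * (q ^ 5 + 1) / 2 ∧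
    gdeg2D q 5 {1, 2, 3} {1} =
      q ^ 6 * (q ^ 2 + 1) * (q ^ 4 + 1) * (q ^ 4 - q ^ 3 + q ^ 2 - q + 1) ∧
    gdeg2D q 5 {1, 2, 4} {0} =
      q ^ 3 * (q ^ 2 + q + 1) * (q ^ 4 + 1) * (q ^ 4 - q ^ 3 + q ^ 2 - q + 1) / 2 := by
  have h1 := (pow_two_mul_sub_one_pos hq (le_refl 1)).ne'
  have h2 := (pow_two_mul_sub_one_pos hq (by norm_num : 1 ≤ 2)).ne'
  have h3 := (pow_two_mul_sub_one_pos hq (by norm_num : 1 ≤ 3)).ne'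
  have h4 := (pow_two_mul_sub_one_pos hq (by norm_num : 1 ≤ 4)).ne'
  norm_num only at h1 h2 h3 h4
  have h5 : q ≠ 0 := by positivity
  refine ⟨?_, ?_, ?_, ?_, ?_, ?_, ?_⟩ <;>
  · simp [gdeg2D, prodDiff, prodSum, prodDen, symbN, sum_range_succ, prod_Icc_succ_top]
    field_simp
    ring

lemma gdeg2D_five_six_entries (hq : 1 < q) :
    gdeg2D q 5 {0, 1, 2, 3} {1, 4} =
      q ^ 7 * (q ^ 2 + q + 1) * (q ^ 4 + 1) * (q ^ 4 - q ^ 3 + q ^ 2 - q + 1) / 2 ∧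
    gdeg2D q 5 {0, 1, 2, 3} {2, 3} =
      q ^ 10 * (q ^ 4 + 1) * (q ^ 4 - q ^ 3 + q ^ 2 - q + 1) ∧
    gdeg2D q 5 {0, 1, 2, 4} {1, 3} = q ^ 7 * (q + 1) ^ 2 * (q ^ 3 + 1) * (q ^ 5 + 1) / 2 ∧
    gdeg2D q 5 {0, 1, 2, 5} {1, 2} =
      q ^ 6 * (q ^ 2 + q + 1) * (q ^ 2 - q + 1) * (q ^ 4 + 1) ∧
    gdeg2D q 5 {0, 1, 3, 4} {1, 2} =
      q ^ 7 * (q ^ 2 + q + 1) * (q ^ 2 + 1) ^ 2 * (q ^ 4 - q ^ 3 + q ^ 2 - q + 1) / 2 ∧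
    gdeg2D q 5 {1, 2, 3, 4} {0, 1} =
      q ^ 7 * (q ^ 2 - q + 1) * (q ^ 4 + 1) * (q ^ 4 - q ^ 3 + q ^ 2 - q + 1) / 2 := by
  have h1 := (pow_two_mul_sub_one_pos hq (le_refl 1)).ne'
  have h2 := (pow_two_mul_sub_one_pos hq (by norm_num : 1 ≤ 2)).ne'
  have h3 := (pow_two_mul_sub_one_pos hq (by norm_num : 1 ≤ 3)).ne'
  have h4 := (pow_two_mul_sub_one_pos hq (by norm_num : 1 ≤ 4)).ne'
  have h5 := (pow_two_mul_sub_one_pos hq (by norm_num : 1 ≤ 5)).ne'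
  norm_num only at h1 h2 h3 h4 h5
  have h6 : q ≠ 0 := by positivity
  refine ⟨?_, ?_, ?_, ?_, ?_, ?_⟩ <;>
  · simp [gdeg2D, prodDiff, prodSum, prodDen, symbN, sum_range_succ, prod_Icc_succ_top, Nat.choose]
    field_simp
    ring

lemma gdeg2D_five_many_entries (hq : 1 < q) :
    gdeg2D q 5 {0, 1, 2, 3, 4} {1, 2, 4} =
      q ^ 13 * (q ^ 2 + q + 1) * (q ^ 4 - q ^ 3 + q ^ 2 - q + 1) ∧
    gdeg2D q 5 {0, 1, 2, 3, 5} {1, 2, 3} = q ^ 12 * (q ^ 2 + 1) * (q ^ 4 + 1) ∧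
    gdeg2D q 5 {0, 1, 2, 3, 4, 5} {1, 2, 3, 4} = q ^ 20 := by
  have h1 := (pow_two_mul_sub_one_pos hq (le_refl 1)).ne'
  have h2 := (pow_two_mul_sub_one_pos hq (by norm_num : 1 ≤ 2)).ne'
  have h3 := (pow_two_mul_sub_one_pos hq (by norm_num : 1 ≤ 3)).ne'
  have h4 := (pow_two_mul_sub_one_pos hq (by norm_num : 1 ≤ 4)).ne'
  have h5 := (pow_two_mul_sub_one_pos hq (by norm_num : 1 ≤ 5)).ne'
  norm_num only at h1 h2 h3 h4 h5
  have h6 : q ≠ 0 := by positivity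
  refine ⟨?_, ?_, ?_⟩ <;>
  · simp [gdeg2D, prodDiff, prodSum, prodDen, symbN, sum_range_succ, prod_Icc_succ_top, Nat.choose]
    field_simp
    ring

/-- The symbols of rank five covered by the degree bound. -/
def symbolsFive : List (Finset ℕ × Finset ℕ) :=
  [({0, 1, 2}, {4}), ({0, 1, 3}, {3}), ({0, 1, 4}, {2}), ({0, 2, 3}, {2}), ({0, 2, 4}, {1}),
    ({1, 2, 3}, {1}), ({1, 2, 4}, {0}), ({0, 1, 2, 3}, {1, 4}), ({0, 1, 2, 3}, {2, 3}),
    ({0, 1, 2, 4}, {1, 3}), ({0, 1, 2, 5}, {1, 2}), ({0, 1, 3, 4}, {1, 2}),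
    ({1, 2, 3, 4}, {0, 1}), ({0, 1, 2, 3, 4}, {1, 2, 4}), ({0, 1, 2, 3, 5}, {1, 2, 3}),
    ({0, 1, 2, 3, 4, 5}, {1, 2, 3, 4})]

set_option maxHeartbeats 2000000 in
lemma lt_gdeg2D_of_mem_symbolsFive (hq : 2 ≤ q) {l m : Finset ℕ} (h : (l, m) ∈ symbolsFive) :
    q ^ 10 < gdeg2D q 5 l m := by
  have hq1 : 1 < q := by linarith
  obtain ⟨a1, a2, a3, a4, a5, a6, a7⟩ := gdeg2D_five_four_entries hq1
  obtain ⟨b1, b2, b3, b4, b5, b6⟩ := gdeg2D_five_six_entries hq1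
  obtain ⟨c1, c2, c3⟩ := gdeg2D_five_many_entries hq1
  obtain ⟨t, ht, rfl⟩ : ∃ t : ℚ, 0 ≤ t ∧ q = t + 2 := ⟨q - 2, by linarith, by ring⟩
  simp only [symbolsFive, List.mem_cons, List.not_mem_nil, or_false, Prod.mk.injEq] at h
  rcases h with h | h | h | h | h | h | h | h | h | h | h | h | h | h | h | h <;>
  · obtain ⟨rfl, rfl⟩ := h
    simp only [a1, a2, a3, a4, a5, a6, a7, b1, b2, b3, b4, b5, b6, c1, c2, c3]
    rw [← sub_pos]
    ring_nf
    positivity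

lemma mem_symbolsFive_of_subset : ∀ l ∈ powerset (range 6), ∀ m ∈ powerset (range 6),
    m.card < l.card → 3 ≤ l.card + m.card → l.card % 4 = (m.card + 2) % 4 →
    l.sum id + m.sum id + (l.card + m.card) / 2 =
      ((l.card + m.card) / 2) * ((l.card + m.card) / 2) + 5 →
    ¬(0 ∈ l ∧ 0 ∈ m) → (l, m) ∈ ({0, 1, 5}, {1}) :: symbolsFive := by
  decide +kernel

end RankFive

lemma gdeg2D_insert_top {q : ℚ} (hq : 1 < q) {k : ℕ} {s : Finset ℕ} (hk : k ∉ s) (m : Finset ℕ) :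
    gdeg2D q (k + 1) (insert k s) m =
      (q ^ (k + 1) + 1) * (∏ y ∈ s, |q ^ k - q ^ y|) * (∏ z ∈ m, (q ^ k + q ^ z)) *
        (prodDiff q s * prodDiff q m * prodSum q s m /
          (2 ^ ((s.card + 1 + m.card - 2) / 2) * q ^ symbN (s.card + 1) m.card *
            prodDen q s * prodDen q m)) := by
  have h1 := (prod_pow_sub_one_pos hq k).ne'
  have h2 := (prodDen_pos hq s).ne'
  have h3 := (prodDen_pos hq m).ne'
  have h4 : q ≠ 0 := by positivity
  rw [gdeg2D, prodDiff_insert hq hk, prodSum_insert hk, prodDen_insert hk,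
    card_insert_of_notMem hk, Nat.add_sub_cancel]
  field_simp

lemma pow_lt_of_pow_mul_lt {q d : ℚ} (hq : 1 < q) {k : ℕ} (hk : 2 ≤ k)
    (h : (q ^ k) ^ 4 < d * q ^ 6) : q ^ (4 * (k + 1) - 10) < d := by
  refine lt_of_mul_lt_mul_right ?_ (by positivity : 0 ≤ q ^ 6)
  rwa [← pow_add, show 4 * (k + 1) - 10 + 6 = k * 4 by omega, pow_mul]

lemma gdeg2D_four_entries {q : ℚ} (hq : 1 < q) {k : ℕ} (hk : 3 ≤ k) :
    gdeg2D q (k + 1) {k, 0, 1} {2} =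
      (q ^ k * q + 1) * (q ^ k - 1) * (q ^ k - q) * (q ^ k + q ^ 2) / (2 * (q ^ 2 - 1) ^ 2) ∧
    gdeg2D q (k + 1) {k, 0, 2} {1} =
      (q ^ k * q + 1) * (q ^ k - 1) * (q ^ k - q ^ 2) * (q ^ k + q) * (q + 1) ^ 2 /
        (2 * ((q ^ 2 - 1) * (q ^ 4 - 1))) ∧
    gdeg2D q (k + 1) {k, 1, 2} {0} =
      (q ^ k * q + 1) * (q ^ k - q) * (q ^ k - q ^ 2) * (q ^ k + 1) / (2 * (q ^ 2 - 1) ^ 2) ∧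
    gdeg2D q (k + 1) {k} {0, 1, 2} =
      (q ^ k * q + 1) * (q ^ k + 1) * (q ^ k + q) * (q ^ k + q ^ 2) * (q - 1) ^ 2 /
        (2 * ((q ^ 2 - 1) * (q ^ 4 - 1))) := by
  have h1 := (pow_two_mul_sub_one_pos hq (le_refl 1)).ne'
  have h2 := (pow_two_mul_sub_one_pos hq (by norm_num : 1 ≤ 2)).ne'
  norm_num only at h1 h2
  have h6 : q ≠ 0 := by positivity
  have hab : ∀ y < k, |q ^ k - q ^ y| = q ^ k - q ^ y := fun y hy => by
    rw [abs_of_pos (sub_pos.2 (pow_lt_pow_right₀ hq hy))]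
  have a0 := hab 0 (by omega)
  have a1 := hab 1 (by omega)
  have a2 := hab 2 (by omega)
  rw [pow_zero] at a0
  rw [pow_one] at a1
  refine ⟨?_, ?_, ?_, ?_⟩
  · rw [gdeg2D_insert_top hq (by simp; omega)]
    simp [prodDiff, prodSum, prodDen, symbN, sum_range_succ, prod_Icc_succ_top, pow_succ q k,
      a0, a1]
    field_simp
    ring
  · rw [gdeg2D_insert_top hq (by simp; omega)]
    simp [prodDiff, prodSum, prodDen, symbN, sum_range_succ, prod_Icc_succ_top, pow_succ q k,
      a0, a2]
    field_simp
    ring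
  · rw [gdeg2D_insert_top hq (by simp; omega)]
    simp [prodDiff, prodSum, prodDen, symbN, sum_range_succ, prod_Icc_succ_top, pow_succ q k,
      a1, a2]
    field_simp
    ring
  · rw [← insert_empty_eq k, gdeg2D_insert_top hq (by simp)]
    simp [prodDiff, prodSum, prodDen, symbN, sum_range_succ, prod_Icc_succ_top, pow_succ q k]
    field_simp

set_option maxHeartbeats 2000000 in
lemma lt_gdeg2D_of_four_entries {q : ℚ} (hq : 2 ≤ q) {k : ℕ} (hk : 5 ≤ k) {s m : Finset ℕ}
    (hc : s.card + m.card = 3) (hsum : s.sum id + m.sum id = 3)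
    (hd : (s.card + 1) % 4 = (m.card + 2) % 4) (h0 : ¬(0 ∈ s ∧ 0 ∈ m)) :
    q ^ (4 * (k + 1) - 10) < gdeg2D q (k + 1) (insert k s) m := by
  have hq1 : 1 < q := by linarith
  have hsub : ∀ r : Finset ℕ, r.sum id ≤ 3 → r ∈ powerset (range 4) := fun r hr => by
    refine mem_powerset.2 fun y hy => mem_range.2 ?_
    have := single_le_sum (f := id) (fun _ _ => Nat.zero_le _) hy
    simp only [id] at *
    omega
  have key : ∀ s ∈ powerset (range 4), ∀ m ∈ powerset (range 4), s.card + m.card = 3 →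
      s.sum id + m.sum id = 3 → (s.card + 1) % 4 = (m.card + 2) % 4 → ¬(0 ∈ s ∧ 0 ∈ m) →
      s = {0, 1} ∧ m = {2} ∨ s = {0, 2} ∧ m = {1} ∨ s = {1, 2} ∧ m = {0} ∨
        s = ∅ ∧ m = {0, 1, 2} := by decide
  refine pow_lt_of_pow_mul_lt hq1 (by omega) ?_
  obtain ⟨e1, e2, e3, e4⟩ := gdeg2D_four_entries hq1 (by omega : 3 ≤ k)
  have h3 : 0 < q ^ 2 - 1 := pow_two_mul_sub_one_pos hq1 (le_refl 1)
  have h4 : 0 < q ^ 4 - 1 := pow_two_mul_sub_one_pos hq1 (by norm_num : 1 ≤ 2)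
  have h5 : q ^ 4 ≤ q ^ k := pow_le_pow_right₀ hq1.le (by omega)
  obtain ⟨t, ht, ht'⟩ : ∃ t : ℚ, 0 ≤ t ∧ q ^ k = t + q ^ 4 :=
    ⟨q ^ k - q ^ 4, by linarith, by ring⟩
  obtain ⟨u, hu, hu'⟩ : ∃ u : ℚ, 0 ≤ u ∧ q = u + 2 := ⟨q - 2, by linarith, by ring⟩
  rcases key s (hsub s (by omega)) m (hsub m (by omega)) hc hsum hd h0 with
    ⟨rfl, rfl⟩ | ⟨rfl, rfl⟩ | ⟨rfl, rfl⟩ | ⟨rfl, rfl⟩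
  · rw [e1, div_mul_eq_mul_div, lt_div_iff₀ (by positivity), ht', hu', ← sub_pos]
    ring_nf
    positivity
  · rw [e2, div_mul_eq_mul_div, lt_div_iff₀ (by positivity), ht', hu', ← sub_pos]
    ring_nf
    positivity
  · rw [e3, div_mul_eq_mul_div, lt_div_iff₀ (by positivity), ht', hu', ← sub_pos]
    ring_nf
    positivity
  · rw [insert_empty_eq, e4, div_mul_eq_mul_div, lt_div_iff₀ (by positivity), ht', hu', ← sub_pos]
    ring_nf
    positivity

lemma lt_gdeg2D_six_two_four {q : ℚ} (hq : 2 ≤ q) : q ^ 14 < gdeg2D q 6 {2, 4} ∅ := by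
  have hq1 : 1 < q := by linarith
  have h1 := (pow_two_mul_sub_one_pos hq1 (le_refl 1)).ne'
  have h2 := (pow_two_mul_sub_one_pos hq1 (by norm_num : 1 ≤ 2)).ne'
  have h3 := (pow_two_mul_sub_one_pos hq1 (by norm_num : 1 ≤ 3)).ne'
  have h4 := (pow_two_mul_sub_one_pos hq1 (by norm_num : 1 ≤ 4)).ne'
  have h5 : 0 < q ^ 4 - 1 := pow_two_mul_sub_one_pos hq1 (by norm_num : 1 ≤ 2)
  norm_num only at h1 h2 h3 h4
  have e : gdeg2D q 6 {2, 4} ∅ = q ^ 2 * (q ^ 6 + 1) * (q ^ 10 - 1) / (q ^ 4 - 1) := by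
    simp [gdeg2D, prodDiff, prodSum, prodDen, symbN, prod_Icc_succ_top]
    field_simp
  rw [e, lt_div_iff₀ h5]
  have := one_lt_pow₀ hq1 (by norm_num : 4 ≠ 0)
  have : q ^ 2 * 1 ≤ q ^ 2 * q ^ 4 := by gcongr
  have : q ^ 8 * 1 ≤ q ^ 8 * q ^ 4 := by gcongr
  have : 0 < q ^ 8 := by positivity
  have : 0 < q ^ 14 := by positivity
  nlinarith

lemma symbN_congr {a b a' b' : ℕ} (h : a + b = a' + b') : symbN a b = symbN a' b' := by
  rw [symbN, symbN, h]

lemma prod_pow_sub_one_mul_le {q : ℚ} (hq : 2 ≤ q) (s : ℕ) :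
    (∏ k ∈ Icc 1 s, (q ^ (2 * k) - 1)) * q ^ s.choose 2 ≤
      (∏ y ∈ range s, |q ^ s - q ^ y|) * q ^ ((s + 1).choose 2 + s) := by
  have hq1 : 1 < q := by linarith
  have e1 : s.choose 2 = ∑ y ∈ range s, y := by rw [sum_range_id, Nat.choose_two_right]
  have e2 : (s + 1).choose 2 + s = ∑ y ∈ range s, (s - y + 1) := by
    rw [sum_add_distrib, Nat.choose_two_right, ← sum_range_id, ← sum_range_reflect, sum_range_succ]
    simp
  have e3 : ∏ k ∈ Icc 1 s, (q ^ (2 * k) - 1) = ∏ y ∈ range s, (q ^ (2 * (s - y)) - 1) := by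
    refine prod_nbij' (fun k => s - k) (fun y => s - y) ?_ ?_ ?_ ?_ ?_ <;>
      intro a ha <;> simp only [mem_Icc, mem_range] at * <;> try omega
    rw [Nat.sub_sub_self ha.2]
  rw [e1, e2, e3, ← prod_pow_eq_pow_sum, ← prod_pow_eq_pow_sum, ← prod_mul_distrib,
    ← prod_mul_distrib]
  refine prod_le_prod (fun y hy => ?_) fun y hy => ?_
  · have := pow_two_mul_sub_one_pos hq1 (by have := mem_range.1 hy; omega : 1 ≤ s - y)
    positivity
  · obtain ⟨d, rfl⟩ : ∃ d, s = y + d := ⟨s - y, by have := mem_range.1 hy; omega⟩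
    have hd := one_le_pow₀ hq1.le (n := d)
    have h1 : q ^ (y + d) - q ^ y = q ^ y * (q ^ d - 1) := by ring
    have h2 : 0 ≤ q ^ y * (q ^ d - 1) := mul_nonneg (by positivity) (by linarith)
    rw [h1, abs_of_nonneg h2, Nat.add_sub_cancel_left, pow_succ, two_mul, pow_add]
    have : q ^ y * (q ^ d - 1) * (q ^ d + 1) ≤ q ^ y * (q ^ d - 1) * (q ^ d * q) := by
      gcongr
      nlinarith
    linarith

lemma prodDen_range_mul_le {q : ℚ} (hq : 2 ≤ q) (w : ℕ) :
    prodDen q (range (2 * w)) * q ^ symbN (2 * w) 0 ≤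
      prodDiff q (range (2 * w)) * q ^ (w ^ 3 + 2 * w ^ 2) := by
  have hq1 : 1 < q := by linarith
  induction w with
  | zero => simp [prodDen, prodDiff, symbN]
  | succ w ih =>
    have e1 : symbN (2 * (w + 1)) 0 = (2 * w).choose 2 + symbN (2 * w) 0 := by
      have := symbN_succ_succ (2 * w) 0
      rw [add_zero] at this
      rw [← this]
      exact symbN_congr (by ring)
    have e2 : (2 * w + 1 + 1).choose 2 = 2 * w ^ 2 + 3 * w + 1 := by
      rw [Nat.choose_two_right]
      refine Nat.div_eq_of_eq_mul_left two_pos ?_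
      rw [Nat.add_sub_cancel]
      ring
    have h1 := prod_pow_sub_one_mul_le hq (2 * w)
    have h2 := prod_pow_sub_one_mul_le hq (2 * w + 1)
    have p1 := prod_pow_sub_one_pos hq1 (2 * w)
    have p2 := prod_pow_sub_one_pos hq1 (2 * w + 1)
    have p3 := prodDen_pos hq1 (range (2 * w))
    have p4 := prodDiff_pos hq1 (range (2 * w))
    have n1 : 2 * w ∉ range (2 * w) := by simp
    have n2 : 2 * w + 1 ∉ range (2 * w + 1) := by simp
    rw [e1, show 2 * (w + 1) = 2 * w + 1 + 1 by ring, range_add_one, prodDen_insert n2,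
      prodDiff_insert hq1 n2, range_add_one, prodDen_insert n1, prodDiff_insert hq1 n1,
      ← range_add_one]
    have h3 := mul_le_mul (mul_le_mul ih h1 (by positivity) (by positivity)) h2 (by positivity)
      (by positivity)
    have h4 : q ^ (w ^ 3 + 2 * w ^ 2 + (2 * w) + (2 * w ^ 2 + 3 * w + 1 + (2 * w + 1))) ≤
        q ^ ((w + 1) ^ 3 + 2 * (w + 1) ^ 2) := by
      refine pow_le_pow_right₀ hq1.le ?_
      nlinarith [sq_nonneg w]
    rw [e2] at h2 h3
    set R := ∏ y ∈ range (2 * w), |q ^ (2 * w) - q ^ y|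
    set R' := ∏ y ∈ range (2 * w + 1), |q ^ (2 * w + 1) - q ^ y|
    have hR : 0 ≤ R := prod_nonneg fun _ _ => abs_nonneg _
    have hR' : 0 ≤ R' := prod_nonneg fun _ _ => abs_nonneg _
    refine le_trans ?_ (mul_le_mul_of_nonneg_left h4 (by positivity))
    refine le_of_mul_le_mul_right ?_ (by positivity : 0 < q ^ (2 * w + 1).choose 2)
    refine le_trans (le_of_eq ?_) (h3.trans (le_of_eq ?_)) <;>
    · simp only [pow_add]
      ring

lemma pow_sq_le_prod_pow_sub_one {q : ℚ} (hq : 2 ≤ q) (k : ℕ) :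
    q ^ (k ^ 2) ≤ ∏ i ∈ Icc 1 k, (q ^ (2 * i) - 1) := by
  induction k with
  | zero => simp
  | succ k ih =>
    rw [prod_Icc_succ_top (by omega), show (k + 1) ^ 2 = k ^ 2 + (2 * k + 1) by ring, pow_add]
    have h1 := one_le_pow₀ (by linarith : 1 ≤ q) (n := 2 * k + 1)
    have h2 : q ^ (2 * (k + 1)) = q ^ (2 * k + 1) * q := by ring
    have h3 : q ^ (2 * k + 1) ≤ q ^ (2 * (k + 1)) - 1 := by
      rw [h2]
      nlinarith
    exact mul_le_mul ih h3 (by positivity) (le_trans (by positivity) ih)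

lemma lt_gdeg2D_cuspidal {q : ℚ} (hq : 2 ≤ q) {w : ℕ} (hw : 3 ≤ w) :
    q ^ (4 * w ^ 2 - 10) < gdeg2D q (w ^ 2) (range (2 * w)) ∅ := by
  have hq1 : 1 < q := by linarith
  have p3 := prodDen_pos hq1 (range (2 * w))
  have p4 := prodDiff_pos hq1 (range (2 * w))
  have h1 := prodDen_range_mul_le hq w
  have h2 := pow_sq_le_prod_pow_sub_one hq (w ^ 2 - 1)
  have h9 : 9 ≤ w ^ 2 := by nlinarith
  rw [gdeg2D, prodDiff_empty, prodSum_empty_right, prodDen_empty, card_range, card_empty,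
    lt_div_iff₀ (by positivity), add_zero, show (2 * w - 2) / 2 = w - 1 by omega]
  have h3 : (2 : ℚ) ^ (w - 1) ≤ q ^ (w - 1) := by gcongr
  have h4 : 4 * w ^ 2 - 10 + (w - 1) + (w ^ 3 + 2 * w ^ 2) ≤ w ^ 2 + (w ^ 2 - 1) ^ 2 := by
    obtain ⟨v, rfl⟩ : ∃ v, w = v + 3 := ⟨w - 3, by omega⟩
    have a1 : 4 * (v + 3) ^ 2 - 10 = 4 * v ^ 2 + 24 * v + 26 := by
      rw [show 4 * (v + 3) ^ 2 = 4 * v ^ 2 + 24 * v + 26 + 10 by ring, Nat.add_sub_cancel]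
    have a2 : (v + 3) ^ 2 - 1 = v ^ 2 + 6 * v + 8 := by
      rw [show (v + 3) ^ 2 = v ^ 2 + 6 * v + 8 + 1 by ring, Nat.add_sub_cancel]
    rw [a1, a2, show v + 3 - 1 = v + 2 by omega]
    ring_nf
    nlinarith [sq_nonneg v, Nat.zero_le (v ^ 3), Nat.zero_le (v ^ 4)]
  calc q ^ (4 * w ^ 2 - 10) * (2 ^ (w - 1) * q ^ symbN (2 * w) 0 * prodDen q (range (2 * w)) * 1)
      = q ^ (4 * w ^ 2 - 10) * 2 ^ (w - 1) * (prodDen q (range (2 * w)) * q ^ symbN (2 * w) 0) := by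
        ring
    _ ≤ q ^ (4 * w ^ 2 - 10) * q ^ (w - 1) *
        (prodDiff q (range (2 * w)) * q ^ (w ^ 3 + 2 * w ^ 2)) := by gcongr
    _ = q ^ (4 * w ^ 2 - 10 + (w - 1) + (w ^ 3 + 2 * w ^ 2)) * prodDiff q (range (2 * w)) := by
        rw [pow_add, pow_add]
        ring
    _ ≤ q ^ (w ^ 2 + (w ^ 2 - 1) ^ 2) * prodDiff q (range (2 * w)) := by
        gcongr
        exact hq1.le
    _ = q ^ (w ^ 2) * q ^ ((w ^ 2 - 1) ^ 2) * prodDiff q (range (2 * w)) := by rw [pow_add]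
    _ < (q ^ (w ^ 2) + 1) * q ^ ((w ^ 2 - 1) ^ 2) * prodDiff q (range (2 * w)) := by
        gcongr
        linarith
    _ ≤ (q ^ (w ^ 2) + 1) * (∏ i ∈ Icc 1 (w ^ 2 - 1), (q ^ (2 * i) - 1)) *
        prodDiff q (range (2 * w)) := by gcongr
    _ = _ := by ring

/-- The degree bound for all reduced symbols of rank `n` other than the exceptional ones. -/
def DegreeGap (q : ℚ) (n : ℕ) : Prop :=
  ∀ h l m, IsRowPair n h l m → ¬(0 ∈ l ∧ 0 ∈ m) → (∀ y ∈ l ∪ m, y + 3 ≤ n + h) →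
    ¬(n = 5 ∧ h = 1) → q ^ (4 * n - 10) < gdeg2D q n l m

lemma DegreeGap.lt_gdeg2D {q : ℚ} (hq : 1 < q) {n h : ℕ} {l m : Finset ℕ} (D : DegreeGap q n)
    (H : IsRowPair n h l m) (hb : ∀ y ∈ l ∪ m, y + 3 ≤ n + h) (hn : ¬(n = 5 ∧ h = 1))
    (h0 : 0 ∈ l → 0 ∈ m → 1 ∉ l ∧ ¬(n = 5 ∧ h = 2)) : q ^ (4 * n - 10) < gdeg2D q n l m := by
  by_cases hz : 0 ∈ l ∧ 0 ∈ m
  · obtain ⟨h1, h2⟩ := h0 hz.1 hz.2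
    obtain ⟨l, rfl⟩ := exists_eq_shiftRow hz.1
    obtain ⟨m, rfl⟩ := exists_eq_shiftRow hz.2
    obtain ⟨k, rfl, H'⟩ := H.of_shiftRow
    have hk := H'.one_le
    rw [gdeg2D_shiftRow hq n (by have := H'.card; omega)]
    refine D k l m H' (fun h => h1 ?_) (fun y hy => ?_) (by omega)
    · exact mem_shiftRow.2 (Or.inr ⟨0, h.1, rfl⟩)
    · have : y + 1 ∈ shiftRow l ∪ shiftRow m := by
        rcases mem_union.1 hy with hy | hy
        · exact mem_union_left _ (mem_shiftRow.2 (Or.inr ⟨y, hy, rfl⟩))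
        · exact mem_union_right _ (mem_shiftRow.2 (Or.inr ⟨y, hy, rfl⟩))
      have := hb _ this
      omega
  · exact D h l m H hz hb hn

lemma DegreeGap.lt_gdeg2D_succ {q : ℚ} (hq : 2 ≤ q) {n h x : ℕ} (hn : 5 ≤ n) {s m : Finset ℕ}
    (D : DegreeGap q n) (H : IsRowPair (n + 1) h (insert (x + 1) s) m) (hx : x ∉ s)
    (hx' : x + 1 ∉ s) (hr : q ^ 4 ≤ hookRatio q n x s m) (hbx : x + 3 ≤ n + h)
    (hb : ∀ y ∈ s ∪ m, y + 3 ≤ n + h) (hn1 : ¬(n = 5 ∧ h = 1))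
    (h0 : 0 ∈ insert x s → 0 ∈ m → 1 ∉ insert x s ∧ ¬(n = 5 ∧ h = 2)) :
    q ^ (4 * (n + 1) - 10) < gdeg2D q (n + 1) (insert (x + 1) s) m := by
  have hq1 : 1 < q := by linarith
  have H' : IsRowPair n h (insert x s) m := by
    obtain ⟨h1, h2, h3⟩ := H
    rw [card_insert_of_notMem hx'] at h1 h2
    rw [sum_insert hx'] at h3
    refine ⟨?_, ?_, ?_⟩
    · rwa [card_insert_of_notMem hx]
    · rwa [card_insert_of_notMem hx]
    · rw [sum_insert hx]
      simp only [id] at *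
      omega
  have h1 := D.lt_gdeg2D hq1 H' (fun y hy => by
    rw [insert_union, mem_insert] at hy
    rcases hy with rfl | hy
    · exact hbx
    · exact hb y hy) hn1 h0
  rw [gdeg2D_succ hq1 (by omega) hx hx', show 4 * (n + 1) - 10 = 4 * n - 10 + 4 by omega, pow_add]
  exact mul_lt_mul h1 hr (by positivity) (gdeg2D_pos hq1 _ _ _).le

lemma exists_greatest_notMem {l : Finset ℕ} {k M : ℕ} (hk : k < M) (hkl : k ∉ l) :
    ∃ x < M, x ∉ l ∧ ∀ y, x < y → y < M → y ∈ l := by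
  obtain ⟨x, hx, hmax⟩ := exists_max_image (range M \ l) id ⟨k, by simp [hk, hkl]⟩
  rw [mem_sdiff, mem_range] at hx
  refine ⟨x, hx.1, hx.2, fun y hxy hy => ?_⟩
  by_contra hyl
  have := hmax y (by simp [hy, hyl])
  simp only [id] at this
  omega

/-- If the largest entry and its predecessor lie in the same row, the symbol has many entries. -/
lemma IsRowPair.two_mul_le {n h M : ℕ} {l m : Finset ℕ} (H : IsRowPair n h l m)
    (h0 : ¬(0 ∈ l ∧ 0 ∈ m)) (hM : M + 1 ∈ l) (hM' : M ∈ l) : 2 * (M + 1) ≤ n + h ∧ M + 1 ≤ n := by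
  rw [← insert_erase hM] at H h0
  obtain ⟨j, R⟩ := H.isRemainder (notMem_erase _ _) h0
  have h1 := R.sub_le_of_mem_left (mem_erase.2 ⟨by omega, hM'⟩)
  have h2 := R.nonneg
  omega

lemma IsRowPair.card_of_one {n : ℕ} {l m : Finset ℕ} (H : IsRowPair n 1 l m) {y : ℕ} (hy : y ∈ l) :
    l.card = 2 ∧ m = ∅ := by
  have h1 := H.card
  have h2 := H.defect
  have h3 := card_pos.2 ⟨y, hy⟩
  rw [← card_eq_zero]
  omega

section Step

variable {q : ℚ} {n h M : ℕ} {l m : Finset ℕ}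

lemma DegreeGap.lt_of_isolated_top (hq : 2 ≤ q) (hn : 5 ≤ n) (D : DegreeGap q n) {x : ℕ}
    (H : IsRowPair (n + 1) h l m) (h0 : ¬(0 ∈ l ∧ 0 ∈ m)) (hx : x ∉ l) (hx' : x + 1 ∈ l)
    (hmax : ∀ y ∈ l ∪ m, y ≤ x + 1) (hb : x + 1 + 3 ≤ n + 1 + h) :
    q ^ (4 * (n + 1) - 10) < gdeg2D q (n + 1) l m := by
  obtain ⟨s, hs, rfl⟩ : ∃ s, x + 1 ∉ s ∧ l = insert (x + 1) s :=
    ⟨l.erase (x + 1), notMem_erase _ _, (insert_erase hx').symm⟩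
  have hxs : x ∉ s := fun h => hx (mem_insert_of_mem h)
  have hlt : ∀ y ∈ s, y < x := fun y hy => by
    have := hmax y (by simp [hy])
    have : y ≠ x := fun h => hxs (h ▸ hy)
    have : y ≠ x + 1 := fun h => hs (h ▸ hy)
    omega
  have hmle : ∀ z ∈ m, z ≤ x + 1 := fun z hz => hmax z (by simp [hz])
  have hcard := H.card
  have hdef := H.defect
  have hsum := H.sum
  rw [card_insert_of_notMem hs] at hcard hdef
  rw [sum_insert hs] at hsum
  have h00 : ¬(0 ∈ s ∧ 0 ∈ m) := fun h => h0 ⟨mem_insert_of_mem h.1, h.2⟩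
  obtain ⟨j, R⟩ := H.isRemainder hs h0
  rw [show ((n + 1 : ℕ) : ℤ) - (x + 1 : ℕ) = n - x by push_cast; ring] at R
  have hR := R.nonneg
  by_cases hfour : n = x + 1 ∧ h = 2
  · obtain ⟨rfl, rfl⟩ := hfour
    simp only [id] at *
    exact lt_gdeg2D_of_four_entries hq hn (by omega) (by simp only [id]; omega) hdef h00
  by_cases hone : n = 5 ∧ h = 1
  · obtain ⟨rfl, rfl⟩ := hone
    obtain ⟨hc, rfl⟩ := H.card_of_one (mem_insert_self _ _)
    obtain ⟨a, rfl⟩ := card_eq_one.1 (by simpa using hcard : s.card = 1)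
    have := hlt a (mem_singleton_self a)
    simp only [sum_singleton, sum_empty, id] at hsum
    obtain ⟨rfl, rfl⟩ : x = 3 ∧ a = 2 := by omega
    rw [pair_comm]
    exact lt_gdeg2D_six_two_four hq
  refine D.lt_gdeg2D_succ hq hn H hxs hs (le_hookRatio_top hq hn R hlt hmle (by omega) hfour)
    (by omega) (fun y hy => ?_) hone fun h1 h2 => ?_
  · rcases mem_union.1 hy with hy | hy
    · have := hlt y hy
      omega
    · have := R.sub_le_of_mem_right hy
      have := hmle y hy
      omega
  · exfalso
    have h3 : 0 ∉ s := fun h => h00 ⟨h, h2⟩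
    obtain rfl : x = 0 := by
      rcases mem_insert.1 h1 with h | h
      · exact h.symm
      · exact absurd h h3
    obtain rfl : s = ∅ := eq_empty_of_forall_notMem fun y hy => by have := hlt y hy; omega
    have := card_le_card (fun z hz => mem_range.2 (by have := hmle z hz; omega) : m ⊆ range 2)
    rw [card_range] at this
    rw [card_empty] at hdef
    omega

lemma DegreeGap.lt_of_run (hq : 2 ≤ q) (hn : 5 ≤ n) (D : DegreeGap q n) {x : ℕ}
    (H : IsRowPair (n + 1) h l m) (h0 : ¬(0 ∈ l ∧ 0 ∈ m)) (hx : x ∉ l) (hxM : x + 1 < M + 1)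
    (hrun : ∀ y, x < y → y ≤ M + 1 → y ∈ l) (hmax : ∀ y ∈ l ∪ m, y ≤ M + 1) :
    q ^ (4 * (n + 1) - 10) < gdeg2D q (n + 1) l m := by
  obtain ⟨hM1, hM2⟩ :=
    H.two_mul_le h0 (hrun (M + 1) (by omega) le_rfl) (hrun M (by omega) (by omega))
  have hh := H.one_le
  have hone : ¬(n = 5 ∧ h = 1) := by
    rintro ⟨rfl, rfl⟩
    obtain ⟨hc, rfl⟩ := H.card_of_one (hrun M (by omega) (by omega))
    have : {M, M + 1} = l := eq_of_subset_of_card_le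
      (by simp [insert_subset_iff, hrun M (by omega) (by omega), hrun (M + 1) (by omega) le_rfl])
      (by rw [hc, card_pair (by omega)])
    have hs := H.sum
    rw [← this, sum_pair (by omega)] at hs
    simp at hs
    omega
  have htwo : x = 0 → 0 ∈ m → ¬(n = 5 ∧ h = 2) := by
    rintro rfl hm0 ⟨rfl, rfl⟩
    have hl : l = Icc 1 (M + 1) := by
      ext y
      rw [mem_Icc]
      refine ⟨fun hy => ⟨?_, hmax y (by simp [hy])⟩, fun hy => hrun y hy.1 hy.2⟩
      rcases Nat.eq_zero_or_pos y with rfl | h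
      · exact absurd hy hx
      · exact h
    have hc := H.card
    have hd := H.defect
    have hm := card_pos.2 ⟨0, hm0⟩
    have hs := H.sum
    rw [hl, Nat.card_Icc] at hc hd
    obtain rfl : M = 2 := by omega
    obtain ⟨a, rfl⟩ := card_eq_one.1 (by omega : m.card = 1)
    obtain rfl := mem_singleton.1 hm0
    rw [hl] at hs
    simp [sum_Icc_succ_top] at hs
  obtain ⟨s, hs, rfl⟩ : ∃ s, x + 1 ∉ s ∧ l = insert (x + 1) s :=
    ⟨l.erase (x + 1), notMem_erase _ _, (insert_erase (hrun _ (by omega) (by omega))).symm⟩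
  have hxs : x ∉ s := fun h => hx (mem_insert_of_mem h)
  have hsle : ∀ y ∈ s, y ≤ M + 1 := fun y hy => hmax y (by simp [hy])
  have hmle : ∀ y ∈ m, y ≤ M + 1 := fun y hy => hmax y (by simp [hy])
  have hc : 2 * h - 2 * (M - x) - 2 ≤ #{y ∈ s | y < x} + #{z ∈ m | z ≤ x} := by
    have h1 := card_filter_add_card_filter_not (s := s) (fun y => y < x)
    have h2 := card_filter_add_card_filter_not (s := m) (fun z => z ≤ x)
    have h3 : #{y ∈ s | ¬ y < x} ≤ #(Ioc (x + 1) (M + 1)) := card_le_card fun y hy => by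
      rw [mem_filter] at hy
      have := hsle y hy.1
      have : y ≠ x := fun h => hxs (h ▸ hy.1)
      have : y ≠ x + 1 := fun h => hs (h ▸ hy.1)
      rw [mem_Ioc]
      omega
    have h4 : #{z ∈ m | ¬ z ≤ x} ≤ #(Ioc x (M + 1)) := card_le_card fun z hz => by
      rw [mem_filter] at hz
      have := hmle z hz.1
      rw [mem_Ioc]
      omega
    rw [Nat.card_Ioc] at h3 h4
    have h5 := H.card
    rw [card_insert_of_notMem hs] at h5
    omega
  refine D.lt_gdeg2D_succ hq hn H hxs hs (le_hookRatio_of_large (t := M - x) hq hn (by omega)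
    hxs hs (fun y hy => by have := hsle y hy; omega) hc (by omega))
    (by omega) (fun y hy => ?_) hone fun h1 h2 => ?_
  · have : y ≤ M + 1 := hmax y (by
      rw [insert_union]
      exact mem_insert_of_mem hy)
    omega
  · obtain rfl : x = 0 := by
      rcases mem_insert.1 h1 with h | h
      · exact h.symm
      · exact absurd ⟨mem_insert_of_mem h, h2⟩ h0
    refine ⟨?_, htwo rfl h2⟩
    rw [mem_insert]
    exact fun h => h.elim (by omega) hs

lemma DegreeGap.lt_of_notMem (hq : 2 ≤ q) (hn : 5 ≤ n) (D : DegreeGap q n) {k : ℕ}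
    (H : IsRowPair (n + 1) h l m) (h0 : ¬(0 ∈ l ∧ 0 ∈ m)) (hM : M ∈ l)
    (hmax : ∀ y ∈ l ∪ m, y ≤ M) (hb : M + 3 ≤ n + 1 + h) (hk : k < M) (hkl : k ∉ l) :
    q ^ (4 * (n + 1) - 10) < gdeg2D q (n + 1) l m := by
  obtain ⟨x, hxM, hx, hrun⟩ := exists_greatest_notMem hk hkl
  obtain ⟨M, rfl⟩ : ∃ k, M = k + 1 := ⟨M - 1, by omega⟩
  rcases (Nat.succ_le_of_lt hxM).eq_or_lt with h | h
  · obtain rfl : x = M := by omega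
    exact D.lt_of_isolated_top hq hn H h0 hx hM hmax hb
  · refine D.lt_of_run hq hn H h0 hx h (fun y h1 h2 => ?_) hmax
    rcases h2.eq_or_lt with rfl | h2
    · exact hM
    · exact hrun y h1 h2

lemma DegreeGap.lt_of_eq_range (hq : 2 ≤ q) (hn : 5 ≤ n) (D : DegreeGap q n)
    (H : IsRowPair (n + 1) h (range (M + 1)) m) (h0 : 0 ∉ m) (hmax : ∀ y ∈ m, y < M)
    (hm : m.Nonempty) : q ^ (4 * (n + 1) - 10) < gdeg2D q (n + 1) (range (M + 1)) m := by
  obtain ⟨x', hx', hmin⟩ := exists_min_image m id hm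
  obtain ⟨x, rfl⟩ : ∃ k, x' = k + 1 :=
    ⟨x' - 1, by have : x' ≠ 0 := fun h => h0 (h ▸ hx'); omega⟩
  have hxM := hmax _ hx'
  obtain ⟨M, rfl⟩ : ∃ k, M = k + 1 := ⟨M - 1, by omega⟩
  obtain ⟨hM1, hM2⟩ := H.two_mul_le (M := M) (fun h => h0 h.2) (by simp) (by simp)
  have hh := H.one_le
  obtain ⟨s, hs, rfl⟩ : ∃ s, x + 1 ∉ s ∧ m = insert (x + 1) s :=
    ⟨m.erase (x + 1), notMem_erase _ _, (insert_erase hx').symm⟩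
  have hgt : ∀ y ∈ s, x + 1 < y ∧ y < M + 1 := fun y hy => by
    have h1 := hmin y (mem_insert_of_mem hy)
    have h2 := hmax y (mem_insert_of_mem hy)
    have : y ≠ x + 1 := fun h => hs (h ▸ hy)
    simp only [id] at h1
    omega
  have hxs : x ∉ s := fun h => by have := hgt x h; omega
  have hcard := H.card
  have hsum := H.sum
  rw [card_insert_of_notMem hs, card_range] at hcard
  rw [sum_insert hs] at hsum
  have hc : x + 1 ≤ #{y ∈ s | y < x} + #{z ∈ range (M + 1 + 1) | z ≤ x} := by
    have : range (x + 1) ⊆ {z ∈ range (M + 1 + 1) | z ≤ x} := fun z hz => by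
      simp only [mem_range, mem_filter] at *
      omega
    have := card_le_card this
    rw [card_range] at this
    omega
  have hlast : x + 2 = n + 1 → s = ∅ := fun h => eq_empty_of_forall_notMem fun y hy => by
    have := hgt y hy
    omega
  have hlast' : x + 2 ≠ n + 1 := fun h => by
    rw [hlast h, card_empty] at hcard
    omega
  rw [gdeg2D_comm]
  refine D.lt_gdeg2D_succ hq hn H.symm hxs hs (le_hookRatio_of_large (t := M) hq hn (by omega)
    hxs hs (fun y hy => by have := hgt y hy; omega) hc (by omega))
    (by omega) (fun y hy => ?_) (by omega) fun h1 _ => ?_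
  · rcases mem_union.1 hy with hy | hy
    · have := hgt y hy
      omega
    · have := mem_range.1 hy
      omega
  · obtain rfl : x = 0 := by
      rcases mem_insert.1 h1 with h | h
      · exact h.symm
      · have := hgt 0 h
        omega
    refine ⟨fun h => (mem_insert.1 h).elim (by omega) hs, ?_⟩
    rintro ⟨rfl, rfl⟩
    obtain rfl : M = 1 := by omega
    obtain rfl : s = ∅ := card_eq_zero.1 (by omega)
    simp [sum_range_succ] at hsum

lemma lt_gdeg2D_of_eq_range (hq : 2 ≤ q) (hn : 5 ≤ n) (H : IsRowPair n h (range M) ∅) :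
    q ^ (4 * n - 10) < gdeg2D q n (range M) ∅ := by
  have h1 := H.card
  have h3 := H.sum
  rw [card_range, card_empty] at h1
  obtain rfl : M = 2 * h := by omega
  have h4 := sum_range_id_mul_two (2 * h)
  simp only [id, sum_empty] at h3
  obtain ⟨k, rfl⟩ : ∃ k, h = k + 1 := ⟨h - 1, by have := H.one_le; omega⟩
  rw [show 2 * (k + 1) - 1 = 2 * k + 1 by omega] at h4
  obtain rfl : n = (k + 1) ^ 2 := by nlinarith
  refine lt_gdeg2D_cuspidal hq ?_
  by_contra! hk
  have : k + 1 ≤ 2 := by omega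
  nlinarith

lemma DegreeGap.lt_of_max_mem_left (hq : 2 ≤ q) (hn : 5 ≤ n) (D : DegreeGap q n)
    (H : IsRowPair (n + 1) h l m) (h0 : ¬(0 ∈ l ∧ 0 ∈ m)) (hM : M ∈ l)
    (hmax : ∀ y ∈ l ∪ m, y ≤ M) (hb : M + 3 ≤ n + 1 + h) :
    q ^ (4 * (n + 1) - 10) < gdeg2D q (n + 1) l m := by
  by_cases hl : ∃ k < M, k ∉ l
  · obtain ⟨k, hk, hkl⟩ := hl
    exact D.lt_of_notMem hq hn H h0 hM hmax hb hk hkl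
  push Not at hl
  obtain rfl : l = range (M + 1) := by
    ext y
    rw [mem_range]
    refine ⟨fun hy => Nat.lt_succ_of_le (hmax y (by simp [hy])), fun hy => ?_⟩
    rcases (Nat.le_of_lt_succ hy).eq_or_lt with rfl | h
    · exact hM
    · exact hl y h
  have h0m : 0 ∉ m := fun h => h0 ⟨by simp, h⟩
  by_cases hMm : M ∈ m
  · rw [gdeg2D_comm]
    rw [union_comm] at hmax
    have : M ≠ 0 := fun h => h0m (h ▸ hMm)
    exact D.lt_of_notMem hq hn H.symm (fun h => h0 h.symm) hMm hmax hb (by omega : 0 < M) h0m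
  · rcases m.eq_empty_or_nonempty with rfl | hm
    · exact lt_gdeg2D_of_eq_range hq (by omega) H
    · refine D.lt_of_eq_range hq hn H h0m (fun y hy => ?_) hm
      refine (hmax y (by simp [hy])).lt_of_ne fun h => hMm (h ▸ hy)

lemma DegreeGap.succ (hq : 2 ≤ q) (hn : 5 ≤ n) (D : DegreeGap q n) : DegreeGap q (n + 1) := by
  intro h l m H h0 hb _
  have hne : (l ∪ m).Nonempty := by
    rw [nonempty_iff_ne_empty]
    intro he
    obtain ⟨rfl, rfl⟩ := union_eq_empty.1 he
    have := H.defect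
    simp at this
  obtain ⟨M, hM, hmax⟩ := exists_max_image (l ∪ m) id hne
  rcases mem_union.1 hM with hMl | hMm
  · exact D.lt_of_max_mem_left hq hn H h0 hMl hmax (hb M hM)
  · rw [gdeg2D_comm]
    rw [union_comm] at hmax
    exact D.lt_of_max_mem_left hq hn H.symm (fun h => h0 h.symm) hMm hmax (hb M hM)

end Step

lemma IsRowPair.le_rank {n h : ℕ} {l m : Finset ℕ} (H : IsRowPair n h l m)
    (h0 : ¬(0 ∈ l ∧ 0 ∈ m)) {y : ℕ} (hy : y ∈ l ∪ m) : y ≤ n := by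
  rcases mem_union.1 hy with hy | hy
  · rw [← insert_erase hy] at H h0
    obtain ⟨j, R⟩ := H.isRemainder (notMem_erase _ _) h0
    have := R.nonneg
    omega
  · rw [and_comm, ← insert_erase hy] at h0
    have H' := H.symm
    rw [← insert_erase hy] at H'
    obtain ⟨j, R⟩ := H'.isRemainder (notMem_erase _ _) h0
    have := R.nonneg
    omega

lemma degreeGap_five {q : ℚ} (hq : 2 ≤ q) : DegreeGap q 5 := by
  have key : ∀ h l m, IsRowPair 5 h l m → ¬(0 ∈ l ∧ 0 ∈ m) → (∀ y ∈ l ∪ m, y + 3 ≤ 5 + h) →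
      h ≠ 1 → m.card < l.card → q ^ 10 < gdeg2D q 5 l m := by
    intro h l m H h0 hb hh hlt
    have hc := H.card
    have hs := H.sum
    have h1 := H.one_le
    have hle : ∀ y ∈ l ∪ m, y ∈ range 6 := fun y hy => by
      have := H.le_rank h0 hy
      rw [mem_range]
      omega
    have hhalf : (l.card + m.card) / 2 = h := by omega
    have hmem := mem_symbolsFive_of_subset l
      (mem_powerset.2 fun y hy => hle y (mem_union_left _ hy)) m
      (mem_powerset.2 fun y hy => hle y (mem_union_right _ hy)) hlt (by omega) H.defect
      (by rw [hhalf]; exact hs) h0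
    rcases List.mem_cons.1 hmem with heq | hmem
    · obtain ⟨rfl, rfl⟩ := Prod.mk.inj heq
      have := hb 5 (by simp)
      simp at hc
      omega
    · exact lt_gdeg2D_of_mem_symbolsFive hq hmem
  intro h l m H h0 hb hh
  have hd := H.defect
  rcases lt_trichotomy m.card l.card with hlt | heq | hlt
  · exact key h l m H h0 hb (by omega) hlt
  · omega
  · rw [gdeg2D_comm]
    exact key h m l H.symm (fun h => h0 h.symm) (fun y hy => hb y (by rwa [union_comm]))
      (by omega) hlt

theorem degreeGap {q : ℚ} (hq : 2 ≤ q) {n : ℕ} (hn : 5 ≤ n) : DegreeGap q n := by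
  induction n, hn using Nat.le_induction with
  | base => exact degreeGap_five hq
  | succ n hn ih => exact ih.succ hq hn

lemma gdeg2D_zero_rank {q : ℚ} (hq : 1 < q) {n : ℕ} (hn : 1 ≤ n) : gdeg2D q n {0, n} ∅ = 1 := by
  obtain ⟨k, rfl⟩ : ∃ k, n = k + 1 := ⟨n - 1, by omega⟩
  have h1 := (prod_pow_sub_one_pos hq k).ne'
  have h2 := (sub_pos.2 (one_lt_pow₀ hq k.succ_ne_zero)).ne'
  have h3 : q ^ (k + 1) + 1 ≠ 0 := by positivity
  have h4 : q ^ (2 * (k + 1)) - 1 = (q ^ (k + 1) - 1) * (q ^ (k + 1) + 1) := by ring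
  simp [gdeg2D, prodDiff, prodSum, prodDen, symbN, prod_Icc_succ_top, h4]
  field_simp

lemma gdeg2D_one_pred {q : ℚ} (hq : 1 < q) {n : ℕ} (hn : 3 ≤ n) :
    gdeg2D q n {1, n - 1} ∅ = (q ^ n + 1) * (q ^ (n - 1) - q) / (q ^ 2 - 1) := by
  obtain ⟨k, rfl⟩ : ∃ k, n = k + 1 := ⟨n - 1, by omega⟩
  have h1 : q ^ 1 < q ^ k := pow_lt_pow_right₀ hq (by omega)
  rw [pow_one] at h1
  rw [Nat.add_sub_cancel, pair_comm, gdeg2D_insert_top hq (by simp; omega)]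
  simp [prodDiff, prodSum, prodDen, symbN, abs_of_pos (sub_pos.2 h1)]
  ring

lemma gdeg2D_zero_one_rank {q : ℚ} (hq : 1 < q) {n : ℕ} (hn : 2 ≤ n) :
    gdeg2D q n {0, 1, n} {1} = (q ^ (2 * n) - q ^ 2) / (q ^ 2 - 1) := by
  obtain ⟨k, rfl⟩ : ∃ k, n = k + 1 := ⟨n - 1, by omega⟩
  have h0 : q ≠ 0 := by positivity
  have h1 := (prod_pow_sub_one_pos hq k).ne'
  have h2 := (sub_pos.2 (one_lt_pow₀ hq k.succ_ne_zero)).ne'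
  have h3 : q ^ (k + 1) + 1 ≠ 0 := by positivity
  have h4 : q ^ (2 * (k + 1)) - 1 = (q ^ (k + 1) - 1) * (q ^ (k + 1) + 1) := by ring
  have h5 := (pow_two_mul_sub_one_pos hq (le_refl 1)).ne'
  rw [mul_one] at h5
  have h6 : k ≠ 0 := by omega
  have h7 : 1 ≤ k := by omega
  simp [gdeg2D, prodDiff, prodSum, prodDen, symbN, sum_range_succ, prod_Icc_succ_top, h4,
    h6, h7]
  field_simp
  ring

lemma gdeg2D_two_three {q : ℚ} (hq : 1 < q) :
    gdeg2D q 5 {2, 3} ∅ = q ^ 2 * (q ^ 4 + 1) * (q ^ 5 + 1) / (q + 1) := by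
  have h1 := (pow_two_mul_sub_one_pos hq (le_refl 1)).ne'
  have h2 := (pow_two_mul_sub_one_pos hq (by norm_num : 1 ≤ 2)).ne'
  have h3 := (pow_two_mul_sub_one_pos hq (by norm_num : 1 ≤ 3)).ne'
  norm_num only at h1 h2 h3
  have h4 : q + 1 ≠ 0 := by positivity
  simp [gdeg2D, prodDiff, prodSum, prodDen, symbN, prod_Icc_succ_top]
  field_simp
  ring

lemma degree_two_three_lt {q : ℚ} (hq : 2 ≤ q) :
    q ^ 2 * (q ^ 4 + 1) * (q ^ 5 + 1) / (q + 1) < q ^ 10 := by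
  obtain ⟨t, ht, rfl⟩ : ∃ t : ℚ, 0 ≤ t ∧ q = t + 2 := ⟨q - 2, by linarith, by ring⟩
  rw [div_lt_iff₀ (by positivity), ← sub_pos]
  ring_nf
  positivity

/-- The symbols with an entry close to the rank. -/
lemma IsRowPair.eq_of_lt_add_three {n h : ℕ} {l m : Finset ℕ} (H : IsRowPair n h l m)
    (h0 : ¬(0 ∈ l ∧ 0 ∈ m)) (hlt : m.card < l.card) {y : ℕ} (hy : y ∈ l ∪ m)
    (hyn : n + h < y + 3) :
    (l = {0, n} ∧ m = ∅) ∨ (l = {1, n - 1} ∧ m = ∅) ∨ (l = {0, 1, n} ∧ m = {1}) := by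
  have hle := H.le_rank h0 hy
  have hd := H.defect
  have hc := H.card
  have hh := H.one_le
  have hs := H.sum
  obtain rfl | rfl : h = 1 ∨ h = 2 := by omega
  · obtain rfl : m = ∅ := card_eq_zero.1 (by omega)
    rw [union_empty] at hy
    obtain ⟨a, hy', ha⟩ : ∃ a, y ∉ ({a} : Finset ℕ) ∧ l = {y, a} := by
      obtain ⟨a, ha⟩ := card_eq_one.1 (by rw [card_erase_of_mem hy]; simp at hc; omega :
        (l.erase y).card = 1)
      exact ⟨a, ha ▸ notMem_erase _ _, by rw [← ha, insert_erase hy]⟩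
    subst ha
    rw [sum_insert hy', sum_singleton, sum_empty] at hs
    simp only [id] at hs
    obtain rfl | rfl : a = 0 ∨ a = 1 := by omega
    · obtain rfl : y = n := by omega
      exact Or.inl ⟨pair_comm _ _, rfl⟩
    · obtain rfl : y = n - 1 := by omega
      exact Or.inr (Or.inl ⟨pair_comm _ _, rfl⟩)
  · obtain rfl : y = n := by omega
    obtain ⟨c, rfl⟩ := card_eq_one.1 (by omega : m.card = 1)
    rw [card_singleton] at hc
    rw [sum_singleton] at hs
    simp only [id] at hs
    rcases mem_union.1 hy with hy | hy
    · obtain ⟨a, b, hab, hl⟩ := card_eq_two.1 (by rw [card_erase_of_mem hy]; omega :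
        (l.erase y).card = 2)
      have hsum := add_sum_erase l id hy
      rw [hl, sum_pair hab] at hsum
      rw [← insert_erase hy, hl] at h0 ⊢
      simp only [id] at hsum hs
      simp only [mem_insert, mem_singleton] at h0
      have : c = 1 ∧ (a = 0 ∧ b = 1 ∨ a = 1 ∧ b = 0) := by omega
      obtain ⟨rfl, ⟨rfl, rfl⟩ | ⟨rfl, rfl⟩⟩ := this
      · refine Or.inr (Or.inr ⟨?_, rfl⟩)
        rw [insert_comm, pair_comm y]
      · refine Or.inr (Or.inr ⟨?_, rfl⟩)
        rw [pair_comm 1, insert_comm, pair_comm y]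
    · have := card_mul_card_le l
      obtain rfl := mem_singleton.1 hy
      rw [show l.card = 3 by omega] at this
      simp only [id] at this
      zify at hs
      push_cast at this
      linarith

lemma IsSymbol2D.lt_gdeg2D {q : ℚ} (hq : 2 ≤ q) {n : ℕ} (hn : 5 ≤ n) {l m : Finset ℕ}
    (H : IsSymbol2D n l m) (h1 : ¬(l = {0, n} ∧ m = ∅)) (h2 : ¬(l = {1, n - 1} ∧ m = ∅))
    (h3 : ¬(l = {0, 1, n} ∧ m = {1})) (h4 : ¬(n = 5 ∧ l = {2, 3} ∧ m = ∅)) :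
    q ^ (4 * n - 10) < gdeg2D q n l m := by
  obtain ⟨h, R⟩ := H.isRowPair
  obtain ⟨hlt, -, h0, -⟩ := H
  have hb : ∀ y ∈ l ∪ m, y + 3 ≤ n + h := fun y hy => by
    by_contra hy'
    rcases R.eq_of_lt_add_three h0 hlt hy (by omega) with h | h | h
    · exact h1 h
    · exact h2 h
    · exact h3 h
  refine degreeGap hq hn h l m R h0 hb ?_
  rintro ⟨rfl, rfl⟩
  obtain ⟨y, hy⟩ := card_pos.1 (by omega : 0 < l.card)
  obtain ⟨hc, rfl⟩ := R.card_of_one hy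
  obtain ⟨a, b, hab, rfl⟩ := card_eq_two.1 hc
  have ha := hb a (by simp)
  have hb' := hb b (by simp)
  have hs := R.sum
  rw [sum_pair hab, sum_empty] at hs
  simp only [id] at hs
  have : a = 2 ∧ b = 3 ∨ a = 3 ∧ b = 2 := by omega
  obtain ⟨rfl, rfl⟩ | ⟨rfl, rfl⟩ := this
  · exact h4 ⟨rfl, rfl, rfl⟩
  · exact h4 ⟨rfl, pair_comm _ _, rfl⟩

end GenericDegree

/-- Proposition 3.3: for `q` a prime power, (a) if `n ≥ 6`, every symbol of rank `n` and type
`²D_n` other than `(0,n; )`, `(1,n-1; )`, `(0,1,n; 1)` — whose generic degrees are `1`,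
`(q^n+1)(q^(n-1)-q)/(q^2-1)`, `(q^(2n)-q^2)/(q^2-1)` respectively — has generic degree greater
than `q^(4n-10)`; (b) for `n = 5`, every symbol of rank `5` and type `²D_5` other than the
previous three and `(2,3; )` — the last of generic degree `q^2(q^4+1)(q^5+1)/(q+1) < q^10` —
has generic degree greater than `q^10`.  Consequently (via Lusztig's classification), the same
holds for the unipotent complex characters of `P(CO⁻_(2n)(q)⁰)`. -/
theorem symbol2D_generic_degree_gap (q : ℕ)
    (hq : ∃ p k : ℕ, p.Prime ∧ 0 < k ∧ q = p ^ k) :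
    (∀ n : ℕ, 6 ≤ n →
      gdeg2D (q : ℚ) n {0, n} ∅ = 1 ∧
      gdeg2D (q : ℚ) n {1, n - 1} ∅ =
        ((q : ℚ) ^ n + 1) * ((q : ℚ) ^ (n - 1) - q) / ((q : ℚ) ^ 2 - 1) ∧
      gdeg2D (q : ℚ) n {0, 1, n} {1} =
        ((q : ℚ) ^ (2 * n) - (q : ℚ) ^ 2) / ((q : ℚ) ^ 2 - 1) ∧
      ∀ l m : Finset ℕ, IsSymbol2D n l m →
        (l, m) ∉ ([(({0, n} : Finset ℕ), (∅ : Finset ℕ)), ({1, n - 1}, ∅), ({0, 1, n}, {1})] : List (Finset ℕ × Finset ℕ)) →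
        (q : ℚ) ^ (4 * n - 10) < gdeg2D (q : ℚ) n l m) ∧
    (gdeg2D (q : ℚ) 5 {2, 3} ∅ =
        (q : ℚ) ^ 2 * ((q : ℚ) ^ 4 + 1) * ((q : ℚ) ^ 5 + 1) / ((q : ℚ) + 1) ∧
      (q : ℚ) ^ 2 * ((q : ℚ) ^ 4 + 1) * ((q : ℚ) ^ 5 + 1) / ((q : ℚ) + 1) < (q : ℚ) ^ 10 ∧
      ∀ l m : Finset ℕ, IsSymbol2D 5 l m →
        (l, m) ∉ ([(({0, 5} : Finset ℕ), (∅ : Finset ℕ)), ({1, 4}, ∅), ({0, 1, 5}, {1}), ({2, 3}, ∅)] : List (Finset ℕ × Finset ℕ)) →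
        (q : ℚ) ^ 10 < gdeg2D (q : ℚ) 5 l m) := by
  have h2 : (2 : ℚ) ≤ q := by
    obtain ⟨p, k, hp, hk, rfl⟩ := hq
    exact_mod_cast hp.two_le.trans (Nat.le_self_pow hk.ne' p)
  have h1 : (1 : ℚ) < q := by linarith
  refine ⟨fun n hn => ⟨gdeg2D_zero_rank h1 (by omega), gdeg2D_one_pred h1 (by omega),
    gdeg2D_zero_one_rank h1 (by omega), fun l m H hlm => ?_⟩, gdeg2D_two_three h1,
    degree_two_three_lt h2, fun l m H hlm => ?_⟩
  · simp only [List.mem_cons, List.not_mem_nil, or_false, Prod.mk.injEq, not_or] at hlm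
    exact H.lt_gdeg2D h2 (by omega) hlm.1 hlm.2.1 hlm.2.2 (by omega)
  · simp only [List.mem_cons, List.not_mem_nil, or_false, Prod.mk.injEq, not_or] at hlm
    exact H.lt_gdeg2D h2 le_rfl hlm.1 hlm.2.1 hlm.2.2.1 fun h => hlm.2.2.2 h.2
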